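/- Let β > 0 be fixed (independent of n) and let β_n = β for all n. Then for every x with −2 < x < 2, P-almost surely, for every L > 0 one has limsup_{n→∞} #_n[B(x, L/n)] = ∞ and liminf_{n→∞} #_n[B(x, L/n)] = 0. -/

import Mathlib

open MeasureTheory Filter Topology
open scoped ENNReal

/-- The (unnormalized) density of the Gaussian beta-ensemble with potential `x^2/2`. -/
noncomputable def gaussianDensity (n : ℕ) (β : ℝ) (x : Fin n → ℝ) : ℝ :=
  (∏ p ∈ Finset.univ.filter (fun p : Fin n × Fin n => p.1 < p.2), |x p.1 - x p.2| ^ β) *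
    Real.exp (-((n : ℝ) * β / 2) * ∑ j, (x j) ^ 2 / 2)

/-- The number of points of the configuration `x` lying in the set `I`. -/
noncomputable def countIn (n : ℕ) (x : Fin n → ℝ) (I : Set ℝ) : ℕ :=
  {j : Fin n | x j ∈ I}.ncard

/-- The resolvent kernel `1 / (y - z)`. -/
noncomputable def resolvent1 (z : ℂ) (y : ℝ) : ℂ := ((y : ℂ) - z)⁻¹

/-- The displacement of the line along the vector field `Re (θ / (y - z))` at time `t`. -/
noncomputable def flow (z θ : ℂ) (t y : ℝ) : ℝ := y + t * (θ * resolvent1 z y).re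

/-- The Stieltjes transform of the normalized empirical measure of a configuration. -/
noncomputable def stieltjes {n : ℕ} (z : ℂ) (x : Fin n → ℝ) : ℂ := (∑ j, resolvent1 z (x j)) / n

/-- The sum of the squared moduli of the resolvent kernels of a configuration. -/
noncomputable def sqSum {n : ℕ} (z : ℂ) (x : Fin n → ℝ) : ℝ := ∑ j, ‖resolvent1 z (x j)‖ ^ 2

lemma ofReal_sub_ne_zero {z : ℂ} (hz : 0 < z.im) (y : ℝ) : (y : ℂ) - z ≠ 0 := by
  intro h
  have := congrArg Complex.im h
  simp at this
  linarith

lemma norm_resolvent1_le {z : ℂ} (hz : 0 < z.im) (y : ℝ) : ‖resolvent1 z y‖ ≤ z.im⁻¹ := by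
  unfold resolvent1
  rw [norm_inv]
  apply inv_anti₀ hz
  have := Complex.abs_im_le_norm ((y : ℂ) - z)
  simp only [Complex.sub_im, Complex.ofReal_im, zero_sub, abs_neg] at this
  exact (le_abs_self _).trans this

lemma resolvent1_sub {z : ℂ} (hz : 0 < z.im) (a b : ℝ) :
    resolvent1 z a - resolvent1 z b = ((b - a : ℝ) : ℂ) * (resolvent1 z a * resolvent1 z b) := by
  have h1 := ofReal_sub_ne_zero hz a
  have h2 := ofReal_sub_ne_zero hz b
  unfold resolvent1
  field_simp
  push_cast
  ring

lemma flow_sub {z : ℂ} (hz : 0 < z.im) (θ : ℂ) (t a b : ℝ) :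
    flow z θ t a - flow z θ t b
      = (a - b) * (1 + t * (-θ * (resolvent1 z a * resolvent1 z b)).re) := by
  have h : (θ * resolvent1 z a).re - (θ * resolvent1 z b).re
      = (b - a) * (θ * (resolvent1 z a * resolvent1 z b)).re := by
    rw [← Complex.sub_re, ← mul_sub, resolvent1_sub hz, ← Complex.re_ofReal_mul]
    congr 1
    ring
  simp only [flow, neg_mul, Complex.neg_re]
  linear_combination t * h

/-- Times at which the flow is a small perturbation of the identity. -/
def SmallTime (z : ℂ) (t : ℝ) : Prop := 0 ≤ t ∧ t ≤ z.im ^ 2 / 2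

lemma abs_re_mul_le {θ : ℂ} (hθ : ‖θ‖ ≤ 1) (a b : ℂ) :
    |(-θ * (a * b)).re| ≤ ‖a‖ * ‖b‖ := by
  refine (Complex.abs_re_le_norm _).trans ?_
  rw [norm_mul, norm_neg, norm_mul]
  exact mul_le_of_le_one_left (by positivity) hθ

lemma SmallTime.abs_le {z θ : ℂ} {t : ℝ} (ht : SmallTime z t) (hz : 0 < z.im) (hθ : ‖θ‖ ≤ 1)
    (a b : ℝ) : |t * (-θ * (resolvent1 z a * resolvent1 z b)).re| ≤ 1 / 2 := by
  rw [abs_mul, abs_of_nonneg ht.1]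
  calc t * |(-θ * (resolvent1 z a * resolvent1 z b)).re|
      ≤ (z.im ^ 2 / 2) * (z.im⁻¹ * z.im⁻¹) := by
        gcongr
        · exact ht.2
        · refine (abs_re_mul_le hθ _ _).trans ?_
          gcongr <;> exact norm_resolvent1_le hz _
    _ = 1 / 2 := by field_simp

lemma exp_sub_sq_le {u : ℝ} (hu : |u| ≤ 1 / 2) : Real.exp (u - u ^ 2) ≤ 1 + u := by
  obtain ⟨h1, h2⟩ := abs_le.1 hu
  rcases le_total 0 u with h | h
  · have h3 := Real.add_one_le_exp (-(u - u ^ 2))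
    have h4 : 1 ≤ (1 + u) * Real.exp (-(u - u ^ 2)) := by
      nlinarith [mul_le_mul_of_nonneg_left h3 (by linarith : 0 ≤ 1 + u), pow_nonneg h 3]
    rw [Real.exp_neg, ← div_eq_mul_inv, le_div_iff₀ (Real.exp_pos _)] at h4
    linarith
  · have h3 := Real.quadratic_le_exp_of_nonneg (x := -(u - u ^ 2)) (by nlinarith)
    have h4 : 1 ≤ (1 + u) * Real.exp (-(u - u ^ 2)) := by
      refine le_trans ?_ (mul_le_mul_of_nonneg_left h3 (by linarith : 0 ≤ 1 + u))
      have : 0 ≤ u ^ 2 * (1 + u - u ^ 2 + u ^ 3) / 2 := by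
        have : 0 ≤ 1 + u - u ^ 2 + u ^ 3 := by nlinarith [sq_nonneg u]
        positivity
      nlinarith
    rw [Real.exp_neg, ← div_eq_mul_inv, le_div_iff₀ (Real.exp_pos _)] at h4
    linarith

lemma flow_injective {z θ : ℂ} {t : ℝ} (ht : SmallTime z t) (hz : 0 < z.im) (hθ : ‖θ‖ ≤ 1) :
    Function.Injective (flow z θ t) := by
  intro a b hab
  have h1 := flow_sub hz θ t a b
  have h2 := abs_le.1 (ht.abs_le hz hθ a b)
  rw [hab, sub_self, eq_comm, mul_eq_zero] at h1
  rcases h1 with h1 | h1 <;> linarith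

lemma hasDerivAt_flow {z : ℂ} (hz : 0 < z.im) (θ : ℂ) (t y : ℝ) :
    HasDerivAt (flow z θ t) (1 + t * (-θ * (resolvent1 z y * resolvent1 z y)).re) y := by
  have h0 := ofReal_sub_ne_zero hz y
  have h1 : HasDerivAt (fun y : ℂ => θ * (y - z)⁻¹)
      (-θ * (resolvent1 z y * resolvent1 z y)) (y : ℂ) := by
    have e : -θ * (resolvent1 z y * resolvent1 z y) = θ * (-1 / ((y : ℂ) - z) ^ 2) := by
      rw [resolvent1]
      field_simp
    rw [e]
    exact (((hasDerivAt_id (y : ℂ)).sub_const z).inv h0).const_mul θ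
  exact (hasDerivAt_id y).add (h1.real_of_complex.const_mul t)

/-- Coordinatewise action of the flow. -/
noncomputable def flowMap {n : ℕ} (z θ : ℂ) (t : ℝ) (x : Fin n → ℝ) : Fin n → ℝ :=
  fun i => flow z θ t (x i)

/-- The Jacobian determinant of `flowMap`. -/
noncomputable def flowJac {n : ℕ} (z θ : ℂ) (t : ℝ) (x : Fin n → ℝ) : ℝ :=
  ∏ i, (1 + t * (-θ * (resolvent1 z (x i) * resolvent1 z (x i))).re)

lemma flowMap_injective {n : ℕ} {z θ : ℂ} {t : ℝ} (ht : SmallTime z t) (hz : 0 < z.im)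
    (hθ : ‖θ‖ ≤ 1) : Function.Injective (flowMap (n := n) z θ t) := by
  intro x y h
  ext i
  exact flow_injective ht hz hθ (congrFun h i)

lemma lintegral_image_flowMap {n : ℕ} {z θ : ℂ} {t : ℝ} (ht : SmallTime z t) (hz : 0 < z.im)
    (hθ : ‖θ‖ ≤ 1) {s : Set (Fin n → ℝ)} (hs : MeasurableSet s) (F : (Fin n → ℝ) → ℝ≥0∞) :
    MeasurableSet (flowMap z θ t '' s) ∧ ∫⁻ x in flowMap z θ t '' s, F x
      = ∫⁻ x in s, ENNReal.ofReal (flowJac z θ t x) * F (flowMap z θ t x) := by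
  have hd : ∀ x ∈ s, HasFDerivWithinAt (flowMap z θ t)
      (ContinuousLinearMap.pi fun i =>
        (1 + t * (-θ * (resolvent1 z (x i) * resolvent1 z (x i))).re) •
          ContinuousLinearMap.proj (R := ℝ) (φ := fun _ : Fin n => ℝ) i) s x := by
    intro x _
    rw [hasFDerivWithinAt_pi']
    intro i
    have := (hasDerivAt_flow hz θ t (x i)).comp_hasFDerivAt x
      (ContinuousLinearMap.proj (R := ℝ) (φ := fun _ : Fin n => ℝ) i).hasFDerivAt
    exact this.hasFDerivWithinAt
  have hinj := (flowMap_injective (n := n) ht hz hθ).injOn (s := s)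
  refine ⟨measurable_image_of_fderivWithin hs hd hinj, ?_⟩
  rw [lintegral_image_eq_lintegral_abs_det_fderiv_mul volume hs hd hinj]
  refine lintegral_congr fun x => ?_
  congr 2
  have : ContinuousLinearMap.det (ContinuousLinearMap.pi fun i =>
        (1 + t * (-θ * (resolvent1 z (x i) * resolvent1 z (x i))).re) •
          ContinuousLinearMap.proj (R := ℝ) (φ := fun _ : Fin n => ℝ) i) = flowJac z θ t x := by
    have := ContinuousLinearMap.det_pi (fun i : Fin n =>
      (1 + t * (-θ * (resolvent1 z (x i) * resolvent1 z (x i))).re) • ContinuousLinearMap.id ℝ ℝ)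
    simp only [ContinuousLinearMap.det, ContinuousLinearMap.toLinearMap_smul, LinearMap.det_smul,
      ContinuousLinearMap.coe_id, LinearMap.det_id, Module.finrank_self, pow_one, mul_one] at this
    exact this
  rw [this, abs_of_nonneg]
  refine Finset.prod_nonneg fun i _ => ?_
  linarith [(abs_le.1 (ht.abs_le hz hθ (x i) (x i))).1]

lemma two_mul_sum_lt_add_sum_diag {n : ℕ} (h : Fin n → Fin n → ℝ) (hs : ∀ i j, h i j = h j i) :
    2 * ∑ p ∈ Finset.univ.filter (fun p : Fin n × Fin n => p.1 < p.2), h p.1 p.2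
      + ∑ i, h i i = ∑ i, ∑ j, h i j := by
  have h1 : ∑ p ∈ Finset.univ.filter (fun p : Fin n × Fin n => p.1 < p.2), h p.1 p.2
      = ∑ i, ∑ j, if i < j then h i j else 0 := by
    rw [Finset.sum_filter, Fintype.sum_prod_type]
  have h2 : ∑ i, ∑ j, (if i < j then h i j else 0) = ∑ i, ∑ j, if j < i then h i j else 0 := by
    rw [Finset.sum_comm]
    refine Finset.sum_congr rfl fun i _ => Finset.sum_congr rfl fun j _ => ?_
    rw [hs]
  have h3 : ∑ i, h i i = ∑ i, ∑ j, if i = j then h i j else 0 := by simp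
  rw [two_mul, h1]
  nth_rewrite 2 [h2]
  rw [h3, ← Finset.sum_add_distrib, ← Finset.sum_add_distrib]
  refine Finset.sum_congr rfl fun i _ => ?_
  rw [← Finset.sum_add_distrib, ← Finset.sum_add_distrib]
  refine Finset.sum_congr rfl fun j _ => ?_
  rcases lt_trichotomy i j with h | h | h
  · simp [h, h.not_gt, h.ne]
  · simp [h]
  · simp [h, h.not_gt, h.ne']

/-- The defect in the self-consistent equation of the semicircle law. -/
noncomputable def defect {n : ℕ} (z : ℂ) (x : Fin n → ℝ) : ℂ :=
  stieltjes z x ^ 2 + z * stieltjes z x + 1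

/-- The logarithmic derivative of the density along the complex vector field `1 / (y - z)`. -/
noncomputable def drift {n : ℕ} (β : ℝ) (z : ℂ) (x : Fin n → ℝ) : ℂ :=
  -(β / 2 * n ^ 2 * defect z x) - (1 - β / 2) * ∑ j, resolvent1 z (x j) ^ 2

/-- A bound for the second order change of the density along the flow. -/
noncomputable def curvature {n : ℕ} (β : ℝ) (z : ℂ) (x : Fin n → ℝ) : ℝ :=
  (β / 2 + 1) * sqSum z x ^ 2 + n * β / 4 * sqSum z x

lemma sqSum_nonneg {n : ℕ} (z : ℂ) (x : Fin n → ℝ) : 0 ≤ sqSum z x :=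
  Finset.sum_nonneg fun _ _ => by positivity

lemma drift_eq {n : ℕ} {z : ℂ} (hz : 0 < z.im) (β : ℝ) (x : Fin n → ℝ) :
    drift β z x = -(β / 2) * (∑ j, resolvent1 z (x j)) ^ 2
      - (1 - β / 2) * ∑ j, resolvent1 z (x j) ^ 2
      - n * β / 2 * ∑ j, x j * resolvent1 z (x j) := by
  rcases Nat.eq_zero_or_pos n with rfl | hn
  · simp [drift]
  have hn' : (n : ℂ) ≠ 0 := by exact_mod_cast hn.ne'
  have h1 : ∑ j, (x j : ℂ) * resolvent1 z (x j) = n + z * ∑ j, resolvent1 z (x j) := by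
    rw [Finset.mul_sum]
    have : (n : ℂ) = ∑ _j : Fin n, (1 : ℂ) := by simp
    rw [this, ← Finset.sum_add_distrib]
    refine Finset.sum_congr rfl fun j _ => ?_
    have := ofReal_sub_ne_zero hz (x j)
    unfold resolvent1
    field_simp
    ring
  rw [h1, drift, defect, stieltjes]
  field_simp
  ring

lemma exp_drift_mul_gaussianDensity_le {n : ℕ} {β : ℝ} (hβ : 0 < β) {z θ : ℂ} {t : ℝ}
    (ht : SmallTime z t) (hz : 0 < z.im) (hθ : ‖θ‖ ≤ 1) (x : Fin n → ℝ) :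
    Real.exp (t * (θ * drift β z x).re - t ^ 2 * curvature β z x) * gaussianDensity n β x
      ≤ flowJac z θ t x * gaussianDensity n β (flowMap z θ t x) := by
  set g : Fin n → ℂ := fun i => resolvent1 z (x i) with hg
  set q : Fin n → Fin n → ℝ := fun i j => (-θ * (g i * g j)).re with hq
  set f : Fin n → ℝ := fun i => (θ * g i).re with hf
  have hqs : ∀ i j, q i j = q j i := fun i j => by simp only [hq, mul_comm]
  have hq2 : ∀ i j, q i j ^ 2 ≤ ‖g i‖ ^ 2 * ‖g j‖ ^ 2 := fun i j => by
    rw [← mul_pow, ← sq_abs]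
    exact pow_le_pow_left₀ (abs_nonneg _) (abs_re_mul_le hθ _ _) 2
  have hf2 : ∀ i, f i ^ 2 ≤ ‖g i‖ ^ 2 := fun i => by
    rw [← sq_abs]
    refine pow_le_pow_left₀ (abs_nonneg _) ((Complex.abs_re_le_norm _).trans ?_) 2
    rw [norm_mul]
    exact mul_le_of_le_one_left (norm_nonneg _) hθ
  have hu : ∀ i j, |t * q i j| ≤ 1 / 2 := fun i j => ht.abs_le hz hθ (x i) (x j)
  have hexp : ∀ i j, Real.exp (t * q i j - (t * q i j) ^ 2) ≤ 1 + t * q i j :=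
    fun i j => exp_sub_sq_le (hu i j)
  set Pr := Finset.univ.filter (fun p : Fin n × Fin n => p.1 < p.2) with hPr
  have hpair : (∏ p ∈ Pr, |x p.1 - x p.2| ^ β)
      * Real.exp (β * ∑ p ∈ Pr, (t * q p.1 p.2 - (t * q p.1 p.2) ^ 2))
      ≤ ∏ p ∈ Pr, |flowMap z θ t x p.1 - flowMap z θ t x p.2| ^ β := by
    rw [Finset.mul_sum, Real.exp_sum, ← Finset.prod_mul_distrib]
    refine Finset.prod_le_prod (fun p _ => by positivity) fun p _ => ?_
    have h1 : 0 ≤ 1 + t * q p.1 p.2 := (Real.exp_pos _).le.trans (hexp _ _)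
    have h2 : flowMap z θ t x p.1 - flowMap z θ t x p.2
        = (x p.1 - x p.2) * (1 + t * q p.1 p.2) := flow_sub hz θ t _ _
    rw [h2, abs_mul, abs_of_nonneg h1, Real.mul_rpow (abs_nonneg _) h1, mul_comm β, Real.exp_mul]
    gcongr
    exact hexp _ _
  have hjac : Real.exp (∑ i, (t * q i i - (t * q i i) ^ 2)) ≤ flowJac z θ t x := by
    rw [Real.exp_sum]
    exact Finset.prod_le_prod (fun p _ => by positivity) fun i _ => hexp i i
  have hgauss : Real.exp (-((n : ℝ) * β / 2) * ∑ j, (flowMap z θ t x j) ^ 2 / 2)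
      = Real.exp (-((n : ℝ) * β / 2) * ∑ j, (x j) ^ 2 / 2)
        * Real.exp (-((n : ℝ) * β / 2) * ∑ j, (t * (x j * f j) + t ^ 2 * f j ^ 2 / 2)) := by
    rw [← Real.exp_add, ← mul_add, ← Finset.sum_add_distrib]
    congr 2
    refine Finset.sum_congr rfl fun j _ => ?_
    simp only [flowMap, flow, hf, hg]
    ring
  have hS : ∑ i, ‖g i‖ ^ 2 = sqSum z x := rfl
  have e1 := two_mul_sum_lt_add_sum_diag q hqs
  have e2 := two_mul_sum_lt_add_sum_diag (fun i j => q i j ^ 2) (fun i j => by simp only [hqs i j])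
  have e3 : ∑ i, ∑ j, q i j ^ 2 ≤ sqSum z x ^ 2 := by
    rw [← hS, sq, Finset.sum_mul_sum]
    exact Finset.sum_le_sum fun i _ => Finset.sum_le_sum fun j _ => hq2 i j
  have e4 : ∑ i, f i ^ 2 ≤ sqSum z x := by
    rw [← hS]
    exact Finset.sum_le_sum fun i _ => hf2 i
  have e5 : ∑ i, q i i ^ 2 ≤ ∑ i, ∑ j, q i j ^ 2 :=
    Finset.sum_le_sum fun i _ =>
      Finset.single_le_sum (f := fun j => q i j ^ 2) (fun j _ => sq_nonneg _) (Finset.mem_univ i)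
  have e6 : 0 ≤ ∑ i, q i i ^ 2 := Finset.sum_nonneg fun _ _ => sq_nonneg _
  have e7 : (θ * drift β z x).re = β * ∑ p ∈ Pr, q p.1 p.2 + ∑ i, q i i
      - n * β / 2 * ∑ j, x j * f j := by
    have k1 : ∑ i, ∑ j, q i j = (-θ * (∑ i, g i) ^ 2).re := by
      rw [sq, Finset.sum_mul_sum, Finset.mul_sum, Complex.re_sum]
      refine Finset.sum_congr rfl fun i _ => ?_
      rw [Finset.mul_sum, Complex.re_sum]
    have k2 : ∑ i, q i i = (-θ * ∑ i, g i ^ 2).re := by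
      rw [Finset.mul_sum, Complex.re_sum]
      exact Finset.sum_congr rfl fun i _ => by rw [sq]
    have k3 : ∑ j, x j * f j = (θ * ∑ j, x j * g j).re := by
      rw [Finset.mul_sum, Complex.re_sum]
      refine Finset.sum_congr rfl fun i _ => ?_
      rw [← Complex.re_ofReal_mul]
      congr 1
      ring
    have k4 : ∑ p ∈ Pr, q p.1 p.2 = (∑ i, ∑ j, q i j - ∑ i, q i i) / 2 := by linarith
    rw [k4, k1, k2, k3, drift_eq hz]
    have : θ * (-(β / 2) * (∑ j, g j) ^ 2 - (1 - β / 2) * ∑ j, g j ^ 2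
        - n * β / 2 * ∑ j, x j * g j) = ((β / 2 : ℝ) : ℂ) * (-θ * (∑ j, g j) ^ 2)
        + ((1 - β / 2 : ℝ) : ℂ) * (-θ * ∑ i, g i ^ 2)
        - ((n * β / 2 : ℝ) : ℂ) * (θ * ∑ j, x j * g j) := by
      push_cast
      ring
    rw [this, Complex.sub_re, Complex.add_re, Complex.re_ofReal_mul, Complex.re_ofReal_mul,
      Complex.re_ofReal_mul]
    ring
  have hexpo : t * (θ * drift β z x).re - t ^ 2 * curvature β z x
      ≤ β * ∑ p ∈ Pr, (t * q p.1 p.2 - (t * q p.1 p.2) ^ 2)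
        + ∑ i, (t * q i i - (t * q i i) ^ 2)
        + -((n : ℝ) * β / 2) * ∑ j, (t * (x j * f j) + t ^ 2 * f j ^ 2 / 2) := by
    simp only [mul_pow, Finset.sum_sub_distrib, Finset.sum_add_distrib, ← Finset.mul_sum,
      ← Finset.sum_div]
    rw [e7, curvature]
    have k1 : β * ∑ p ∈ Pr, q p.1 p.2 ^ 2 ≤ β * (sqSum z x ^ 2 / 2) := by
      gcongr
      linarith
    have k2 : n * β / 4 * ∑ i, f i ^ 2 ≤ n * β / 4 * sqSum z x := by gcongr
    have k3 := mul_le_mul_of_nonneg_left (add_le_add (add_le_add k1 k2) (e5.trans e3))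
      (sq_nonneg t)
    linarith
  calc Real.exp (t * (θ * drift β z x).re - t ^ 2 * curvature β z x) * gaussianDensity n β x
      ≤ Real.exp (β * ∑ p ∈ Pr, (t * q p.1 p.2 - (t * q p.1 p.2) ^ 2)
        + ∑ i, (t * q i i - (t * q i i) ^ 2)
        + -((n : ℝ) * β / 2) * ∑ j, (t * (x j * f j) + t ^ 2 * f j ^ 2 / 2))
          * gaussianDensity n β x := by
        gcongr
        unfold gaussianDensity
        positivity
    _ = Real.exp (∑ i, (t * q i i - (t * q i i) ^ 2))
          * (((∏ p ∈ Pr, |x p.1 - x p.2| ^ β)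
              * Real.exp (β * ∑ p ∈ Pr, (t * q p.1 p.2 - (t * q p.1 p.2) ^ 2)))
            * Real.exp (-((n : ℝ) * β / 2) * ∑ j, (flowMap z θ t x j) ^ 2 / 2)) := by
        rw [hgauss, Real.exp_add, Real.exp_add, gaussianDensity]
        ring
    _ ≤ _ := by
        unfold gaussianDensity
        gcongr
        exact (Real.exp_pos _).le.trans hjac

/-- A measure on configurations is a Gaussian beta-ensemble. -/
def IsGaussianEnsemble {n : ℕ} (β : ℝ) (μ : Measure (Fin n → ℝ)) : Prop :=
  IsProbabilityMeasure μ ∧ ∃ Z : ℝ, 0 < Z ∧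
    μ = volume.withDensity (fun x => ENNReal.ofReal (gaussianDensity n β x / Z))

lemma measurable_gaussianDensity (n : ℕ) (β : ℝ) : Measurable (gaussianDensity n β) := by
  unfold gaussianDensity
  fun_prop

lemma continuous_resolvent1 {z : ℂ} (hz : 0 < z.im) : Continuous (resolvent1 z) :=
  Continuous.inv₀ (by fun_prop) (ofReal_sub_ne_zero hz)

lemma continuous_stieltjes {n : ℕ} {z : ℂ} (hz : 0 < z.im) :
    Continuous (stieltjes (n := n) z) := by
  have := continuous_resolvent1 hz
  unfold stieltjes
  fun_prop

lemma continuous_defect {n : ℕ} {z : ℂ} (hz : 0 < z.im) :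
    Continuous (defect (n := n) z) := by
  have := continuous_stieltjes (n := n) hz
  unfold defect
  fun_prop

lemma continuous_sqSum {n : ℕ} {z : ℂ} (hz : 0 < z.im) :
    Continuous (sqSum (n := n) z) := by
  have := continuous_resolvent1 hz
  unfold sqSum
  fun_prop

lemma continuous_drift {n : ℕ} (β : ℝ) {z : ℂ} (hz : 0 < z.im) :
    Continuous (drift (n := n) β z) := by
  have := continuous_resolvent1 hz
  have := continuous_defect (n := n) hz
  unfold drift
  fun_prop

lemma continuous_curvature {n : ℕ} (β : ℝ) {z : ℂ} (hz : 0 < z.im) :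
    Continuous (curvature (n := n) β z) := by
  have := continuous_sqSum (n := n) hz
  unfold curvature
  fun_prop

lemma continuous_exp_drift {n : ℕ} (β : ℝ) {z : ℂ} (hz : 0 < z.im) (θ : ℂ) (t : ℝ) :
    Continuous fun x : Fin n → ℝ =>
      Real.exp (t * (θ * drift β z x).re - t ^ 2 * curvature β z x) :=
  Real.continuous_exp.comp ((continuous_const.mul (Complex.continuous_re.comp
    (continuous_const.mul (continuous_drift β hz)))).sub
      (continuous_const.mul (continuous_curvature β hz)))

lemma IsGaussianEnsemble.lintegral_exp_drift_le {n : ℕ} {β : ℝ} {μ : Measure (Fin n → ℝ)}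
    (hμ : IsGaussianEnsemble β μ) (hβ : 0 < β) {z θ : ℂ} {t : ℝ} (ht : SmallTime z t)
    (hz : 0 < z.im) (hθ : ‖θ‖ ≤ 1) {s : Set (Fin n → ℝ)} (hs : MeasurableSet s) :
    ∫⁻ x in s, ENNReal.ofReal (Real.exp (t * (θ * drift β z x).re - t ^ 2 * curvature β z x)) ∂μ
      ≤ μ (flowMap z θ t '' s) := by
  obtain ⟨-, Z, hZ, rfl⟩ := hμ
  have hd : Measurable fun x => ENNReal.ofReal (gaussianDensity n β x / Z) :=
    ((measurable_gaussianDensity n β).div_const Z).ennreal_ofReal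
  have hF : Measurable fun x : Fin n → ℝ => ENNReal.ofReal
      (Real.exp (t * (θ * drift β z x).re - t ^ 2 * curvature β z x)) := by
    exact (continuous_exp_drift β hz θ t).measurable.ennreal_ofReal
  obtain ⟨hm, himg⟩ := lintegral_image_flowMap ht hz hθ hs
    fun x => ENNReal.ofReal (gaussianDensity n β x / Z)
  rw [withDensity_apply _ hm, himg, setLIntegral_withDensity_eq_setLIntegral_mul _ hd hF hs]
  refine lintegral_mono fun x => ?_
  have hJ : 0 ≤ flowJac z θ t x := Finset.prod_nonneg fun i _ => by
    linarith [(abs_le.1 (ht.abs_le hz hθ (x i) (x i))).1]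
  simp only [Pi.mul_apply]
  rw [← ENNReal.ofReal_mul hJ, mul_comm, ← ENNReal.ofReal_mul (Real.exp_pos _).le]
  refine ENNReal.ofReal_le_ofReal ?_
  rw [← mul_div_assoc, ← mul_div_assoc]
  refine div_le_div_of_nonneg_right ?_ hZ.le
  exact exp_drift_mul_gaussianDensity_le hβ ht hz hθ x

lemma sqSum_le {n : ℕ} {z : ℂ} (hz : 0 < z.im) (x : Fin n → ℝ) :
    sqSum z x ≤ n * (z.im⁻¹) ^ 2 := by
  refine (Finset.sum_le_sum (g := fun _ => (z.im⁻¹) ^ 2) fun i _ =>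
    pow_le_pow_left₀ (norm_nonneg _) (norm_resolvent1_le hz _) 2).trans ?_
  simp

lemma norm_stieltjes_le {n : ℕ} {z : ℂ} (hz : 0 < z.im) (x : Fin n → ℝ) :
    ‖stieltjes z x‖ ≤ z.im⁻¹ := by
  rcases Nat.eq_zero_or_pos n with rfl | hn
  · simpa [stieltjes] using hz.le
  rw [stieltjes, norm_div, Complex.norm_natCast, div_le_iff₀ (by positivity)]
  refine (norm_sum_le_of_le _ fun i _ => norm_resolvent1_le hz (x i)).trans ?_
  simp [mul_comm]

lemma norm_sum_sq_le {n : ℕ} (z : ℂ) (x : Fin n → ℝ) :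
    ‖∑ j, resolvent1 z (x j) ^ 2‖ ≤ sqSum z x :=
  norm_sum_le_of_le _ fun i _ => by rw [norm_pow]

lemma norm_defect_le {n : ℕ} {z : ℂ} (hz : 0 < z.im) (x : Fin n → ℝ) :
    ‖defect z x‖ ≤ (z.im⁻¹) ^ 2 + ‖z‖ * z.im⁻¹ + 1 := by
  have := norm_stieltjes_le hz x
  have hz' : 0 ≤ z.im⁻¹ := by positivity
  refine (norm_add₃_le).trans ?_
  rw [norm_pow, norm_mul, norm_one]
  gcongr

lemma integrable_of_continuous_of_bound {n : ℕ} {E : Type*} [NormedAddCommGroup E]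
    [SecondCountableTopologyEither (Fin n → ℝ) E]
    (μ : Measure (Fin n → ℝ)) [IsProbabilityMeasure μ] {F : (Fin n → ℝ) → E}
    (hF : Continuous F) (C : ℝ) (hC : ∀ x, ‖F x‖ ≤ C) : Integrable F μ :=
  Integrable.of_bound hF.aestronglyMeasurable C (ae_of_all _ hC)

lemma curvature_nonneg {n : ℕ} {β : ℝ} (hβ : 0 < β) (z : ℂ) (x : Fin n → ℝ) :
    0 ≤ curvature β z x := by
  have := sqSum_nonneg z x
  unfold curvature
  positivity

lemma exists_curvature_le (n : ℕ) {β : ℝ} (hβ : 0 < β) {z : ℂ} (hz : 0 < z.im) :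
    ∃ C > 0, ∀ x : Fin n → ℝ, curvature β z x ≤ C := by
  refine ⟨(β / 2 + 1) * (n * (z.im⁻¹) ^ 2) ^ 2 + n * β / 4 * (n * (z.im⁻¹) ^ 2) + 1,
    by positivity, fun x => ?_⟩
  have := sqSum_nonneg z x
  have := sqSum_le hz x
  unfold curvature
  refine le_trans ?_ (le_add_of_nonneg_right zero_le_one)
  gcongr

lemma exists_drift_le (n : ℕ) (β : ℝ) {z : ℂ} (hz : 0 < z.im) :
    ∃ C, ∀ x : Fin n → ℝ, ‖drift β z x‖ ≤ C := by
  refine ⟨‖(β / 2 * n ^ 2 : ℂ)‖ * ((z.im⁻¹) ^ 2 + ‖z‖ * z.im⁻¹ + 1)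
    + ‖(1 - β / 2 : ℂ)‖ * (n * (z.im⁻¹) ^ 2), fun x => ?_⟩
  refine (norm_sub_le _ _).trans ?_
  rw [norm_neg, norm_mul, norm_mul (1 - (β : ℂ) / 2)]
  gcongr
  · exact norm_defect_le hz x
  · exact (norm_sum_sq_le z x).trans (sqSum_le hz x)

lemma IsGaussianEnsemble.integral_exp_drift_le {n : ℕ} {β : ℝ} {μ : Measure (Fin n → ℝ)}
    (hμ : IsGaussianEnsemble β μ) (hβ : 0 < β) {z θ : ℂ} {t : ℝ} (ht : SmallTime z t)
    (hz : 0 < z.im) (hθ : ‖θ‖ ≤ 1) :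
    Integrable (fun x => Real.exp (t * (θ * drift β z x).re - t ^ 2 * curvature β z x)) μ ∧
    ∫ x, Real.exp (t * (θ * drift β z x).re - t ^ 2 * curvature β z x) ∂μ ≤ 1 := by
  have hp := hμ.1
  have h := hμ.lintegral_exp_drift_le hβ ht hz hθ MeasurableSet.univ
  have h3 := h.trans prob_le_one
  rw [Measure.restrict_univ] at h3
  have hc := continuous_exp_drift (n := n) β hz θ t
  refine ⟨?_, ?_⟩
  · obtain ⟨C, hC⟩ := exists_drift_le n β hz
    refine integrable_of_continuous_of_bound μ hc (Real.exp (t * C)) fun x => ?_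
    rw [Real.norm_of_nonneg (Real.exp_pos _).le]
    refine Real.exp_le_exp.2 ?_
    have k1 : (θ * drift β z x).re ≤ C := by
      refine (le_abs_self _).trans ((Complex.abs_re_le_norm _).trans ?_)
      rw [norm_mul]
      exact (mul_le_of_le_one_left (norm_nonneg _) hθ).trans (hC x)
    have k2 := mul_le_mul_of_nonneg_left k1 ht.1
    have k3 := mul_nonneg (sq_nonneg t) (curvature_nonneg hβ z x)
    linarith
  · rw [integral_eq_lintegral_of_nonneg_ae (ae_of_all _ fun x => (Real.exp_pos _).le)
      hc.aestronglyMeasurable]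
    exact ENNReal.toReal_le_of_le_ofReal zero_le_one (by simpa using h3)

lemma two_add_sq_le_exp_add_exp_neg (a : ℝ) : 2 + a ^ 2 ≤ Real.exp a + Real.exp (-a) := by
  have h1 : |a / 2| ≤ |Real.sinh (a / 2)| := by
    rw [Real.abs_sinh]
    exact Real.self_le_sinh_iff.2 (abs_nonneg _)
  have h2 := sq_le_sq.2 h1
  have h3 := Real.cosh_two_mul (a / 2)
  rw [Real.cosh_sq, mul_div_cancel₀ a two_ne_zero, Real.cosh_eq] at h3
  linarith

/-- Second moment bound for the drift in a fixed direction. -/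
lemma IsGaussianEnsemble.integral_drift_re_sq_le {n : ℕ} {β : ℝ} {μ : Measure (Fin n → ℝ)}
    (hμ : IsGaussianEnsemble β μ) (hβ : 0 < β) {z θ : ℂ} (hz : 0 < z.im) (hθ : ‖θ‖ ≤ 1) :
    ∫ x, (θ * drift β z x).re ^ 2 ∂μ ≤ 4 * ∫ x, curvature β z x ∂μ := by
  have hp := hμ.1
  obtain ⟨C, hC0, hC⟩ := exists_curvature_le n hβ hz
  obtain ⟨D, hD⟩ := exists_drift_le n β hz
  obtain ⟨t, ht0, ht1, ht2⟩ : ∃ t : ℝ, 0 < t ∧ t ≤ z.im ^ 2 / 2 ∧ t ^ 2 * C ≤ 1 / 2 := by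
    refine ⟨min (min (z.im ^ 2 / 2) 1) (1 / (2 * C)), by positivity,
      (min_le_left _ _).trans (min_le_left _ _), ?_⟩
    set t := min (min (z.im ^ 2 / 2) 1) (1 / (2 * C)) with ht
    have h0 : 0 < t := by positivity
    have h1 : t ≤ 1 := (min_le_left _ _).trans (min_le_right _ _)
    have h2 : t ≤ 1 / (2 * C) := min_le_right _ _
    rw [le_div_iff₀ (by positivity)] at h2
    nlinarith
  have hcA := continuous_drift (n := n) β hz
  have hcB := continuous_curvature (n := n) β hz
  have hiB : Integrable (curvature (n := n) β z) μ :=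
    integrable_of_continuous_of_bound μ hcB C fun x => by
      rw [Real.norm_of_nonneg (curvature_nonneg hβ z x)]
      exact hC x
  have hiA : Integrable (fun x : Fin n → ℝ => (θ * drift β z x).re ^ 2) μ := by
    refine integrable_of_continuous_of_bound μ
      ((Complex.continuous_re.comp (continuous_const.mul hcA)).pow 2) (D ^ 2) fun x => ?_
    rw [Real.norm_of_nonneg (sq_nonneg _), ← sq_abs]
    refine pow_le_pow_left₀ (abs_nonneg _) ((Complex.abs_re_le_norm _).trans ?_) 2
    rw [norm_mul]
    exact (mul_le_of_le_one_left (norm_nonneg _) hθ).trans (hD x)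
  obtain ⟨i1, b1⟩ := hμ.integral_exp_drift_le hβ ⟨ht0.le, ht1⟩ hz hθ
  obtain ⟨i2, b2⟩ := hμ.integral_exp_drift_le hβ ⟨ht0.le, ht1⟩ hz
    (θ := -θ) (by rwa [norm_neg])
  have hpt : ∀ x : Fin n → ℝ, 2 - 2 * t ^ 2 * curvature β z x
      + t ^ 2 / 2 * (θ * drift β z x).re ^ 2
      ≤ Real.exp (t * (θ * drift β z x).re - t ^ 2 * curvature β z x)
        + Real.exp (t * (-θ * drift β z x).re - t ^ 2 * curvature β z x) := by
    intro x
    have e : (-θ * drift β z x).re = -(θ * drift β z x).re := by simp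
    set a := (θ * drift β z x).re
    set b := curvature β z x
    have hb0 : 0 ≤ b := curvature_nonneg hβ z x
    have hb : t ^ 2 * b ≤ 1 / 2 := le_trans (by gcongr; exact hC x) ht2
    rw [e, sub_eq_add_neg (t * a), Real.exp_add, sub_eq_add_neg (t * -a), Real.exp_add, ← add_mul,
      mul_neg t a]
    have h1 := two_add_sq_le_exp_add_exp_neg (t * a)
    have h2 := Real.add_one_le_exp (-(t ^ 2 * b))
    have h3 : (2 + (t * a) ^ 2) * (-(t ^ 2 * b) + 1)
        ≤ (Real.exp (t * a) + Real.exp (-(t * a))) * Real.exp (-(t ^ 2 * b)) := by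
      gcongr
      linarith
    refine le_trans ?_ h3
    have h4 : 0 ≤ (t * a) ^ 2 * (1 / 2 - t ^ 2 * b) :=
      mul_nonneg (sq_nonneg _) (by linarith)
    nlinarith
  have i3 : Integrable (fun x : Fin n → ℝ => 2 - 2 * t ^ 2 * curvature β z x) μ :=
    (integrable_const (2 : ℝ)).sub (hiB.const_mul (2 * t ^ 2))
  have hint := integral_mono (μ := μ) (i3.add (hiA.const_mul (t ^ 2 / 2))) (i1.add i2) hpt
  simp only [Pi.add_apply] at hint
  rw [integral_add i1 i2, integral_add i3 (hiA.const_mul (t ^ 2 / 2)),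
    integral_sub (integrable_const _) (hiB.const_mul _),
    integral_const_mul, integral_const_mul] at hint
  simp only [integral_const, probReal_univ, smul_eq_mul, one_mul] at hint
  have : t ^ 2 * (∫ x, (θ * drift β z x).re ^ 2 ∂μ) ≤ t ^ 2 * (4 * ∫ x, curvature β z x ∂μ) := by
    linarith
  exact le_of_mul_le_mul_left this (by positivity)

lemma im_mul_sqSum {n : ℕ} (z : ℂ) (x : Fin n → ℝ) :
    z.im * sqSum z x = n * (stieltjes z x).im := by
  rcases Nat.eq_zero_or_pos n with rfl | hn
  · simp [sqSum]
  have hn' : (n : ℝ) ≠ 0 := by exact_mod_cast hn.ne'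
  rw [stieltjes, Complex.div_natCast_im, mul_div_cancel₀ _ hn', sqSum, Complex.im_sum,
    Finset.mul_sum]
  refine Finset.sum_congr rfl fun j _ => ?_
  rw [resolvent1, Complex.inv_im, norm_inv, inv_pow, ← Complex.normSq_eq_norm_sq]
  simp [div_eq_mul_inv]

lemma sqSum_le_norm_stieltjes {n : ℕ} {z : ℂ} {K : ℝ} (hK : 0 < K) (hn : 0 < n)
    (hz : z.im = K / n) (x : Fin n → ℝ) : sqSum z x ≤ n ^ 2 * (‖stieltjes z x‖ / K) := by
  have h := im_mul_sqSum z x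
  have hn' : (0 : ℝ) < n := by exact_mod_cast hn
  have h1 := (le_abs_self _).trans (Complex.abs_im_le_norm (stieltjes z x))
  rw [hz] at h
  have : sqSum z x = n ^ 2 * ((stieltjes z x).im / K) := by
    field_simp at h ⊢
    linarith
  rw [this]
  gcongr

lemma norm_stieltjes_sq_le {n : ℕ} (z : ℂ) (x : Fin n → ℝ) :
    ‖stieltjes z x‖ ^ 2 ≤ 2 * ‖defect z x‖ + ‖z‖ ^ 2 + 2 := by
  have h : stieltjes z x ^ 2 = defect z x - z * stieltjes z x - 1 := by
    rw [defect]
    ring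
  have h1 : ‖stieltjes z x‖ ^ 2 ≤ ‖defect z x‖ + ‖z‖ * ‖stieltjes z x‖ + 1 := by
    rw [← norm_pow, h, ← norm_mul]
    refine (norm_sub_le _ _).trans ?_
    rw [norm_one]
    gcongr
    exact norm_sub_le _ _
  nlinarith [sq_nonneg (‖z‖ - ‖stieltjes z x‖)]

lemma curvature_le {n : ℕ} {β : ℝ} (hβ : 0 < β) {z : ℂ} {K : ℝ} (hK : 0 < K) (hn : 0 < n)
    (hKn : K ≤ n) (hz : z.im = K / n) (x : Fin n → ℝ) :
    curvature β z x ≤ 2 * (1 + β / 2) * (n ^ 4 / K ^ 2 * (‖stieltjes z x‖ ^ 2 + 1)) := by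
  have hn' : (0 : ℝ) < n := by exact_mod_cast hn
  have h0 := sqSum_nonneg z x
  have h1 := sqSum_le_norm_stieltjes hK hn hz x
  set S := sqSum z x
  set m := ‖stieltjes z x‖ with hm
  have hm0 : 0 ≤ m := norm_nonneg _
  have h2 : S ^ 2 ≤ n ^ 4 / K ^ 2 * m ^ 2 := by
    refine (pow_le_pow_left₀ h0 h1 2).trans_eq ?_
    field_simp
  have h3 : n * S ≤ n ^ 4 / K ^ 2 * m := by
    calc n * S ≤ n * (n ^ 2 * (m / K)) := by gcongr
      _ = n ^ 3 * K / K ^ 2 * m := by field_simp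
      _ ≤ n ^ 3 * n / K ^ 2 * m := by gcongr
      _ = _ := by ring
  have h4 : n ^ 4 / K ^ 2 * m ≤ n ^ 4 / K ^ 2 * (m ^ 2 + 1) := by
    gcongr
    nlinarith [sq_nonneg (m - 1)]
  have h5 : n ^ 4 / K ^ 2 * m ^ 2 ≤ n ^ 4 / K ^ 2 * (m ^ 2 + 1) := by
    gcongr
    linarith
  have h6 : 0 ≤ n * S := by positivity
  rw [curvature]
  calc (β / 2 + 1) * S ^ 2 + n * β / 4 * S
      ≤ (1 + β / 2) * (S ^ 2 + n * S) := by nlinarith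
    _ ≤ (1 + β / 2) * (n ^ 4 / K ^ 2 * (m ^ 2 + 1) + n ^ 4 / K ^ 2 * (m ^ 2 + 1)) := by
        exact mul_le_mul_of_nonneg_left (by linarith) (by positivity)
    _ = _ := by ring

lemma integrable_norm_sq {n : ℕ} (μ : Measure (Fin n → ℝ)) [IsProbabilityMeasure μ]
    {F : (Fin n → ℝ) → ℂ} (hF : Continuous F) {C : ℝ} (hC : ∀ x, ‖F x‖ ≤ C) :
    Integrable (fun x => ‖F x‖ ^ 2) μ := by
  refine integrable_of_continuous_of_bound μ (hF.norm.pow 2) (C ^ 2) fun x => ?_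
  rw [Real.norm_of_nonneg (sq_nonneg _)]
  exact pow_le_pow_left₀ (norm_nonneg _) (hC x) 2

/-- The self-consistent equation holds in mean square, in terms of the Stieltjes transform. -/
lemma exists_integral_defect_sq_le {β : ℝ} (hβ : 0 < β) :
    ∃ C > 0, ∀ {n : ℕ} {μ : Measure (Fin n → ℝ)}, IsGaussianEnsemble β μ → ∀ {K : ℝ} {z : ℂ},
      0 < n → 0 < K → K ≤ n → z.im = K / n →
      ∫ x, ‖defect z x‖ ^ 2 ∂μ ≤ C / K ^ 2 * (∫ x, ‖stieltjes z x‖ ^ 2 ∂μ + 1) := by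
  refine ⟨4 * (32 * (1 + β / 2) + 2 * (1 + β / 2) ^ 2) / β ^ 2, by positivity, ?_⟩
  intro n μ hμ K z hn hK hKn hz
  have hp := hμ.1
  have hn' : (0 : ℝ) < n := by exact_mod_cast hn
  have hz0 : 0 < z.im := by rw [hz]; positivity
  obtain ⟨D, hD⟩ := exists_drift_le n β hz0
  have iA := integrable_norm_sq μ (continuous_drift β hz0) hD
  have iD := integrable_norm_sq μ (continuous_defect hz0) (norm_defect_le hz0)
  have im := integrable_norm_sq μ (continuous_stieltjes hz0) (norm_stieltjes_le hz0)
  obtain ⟨B, -, hB⟩ := exists_curvature_le n hβ hz0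
  have iB : Integrable (curvature (n := n) β z) μ :=
    integrable_of_continuous_of_bound μ (continuous_curvature β hz0) B fun x => by
      rw [Real.norm_of_nonneg (curvature_nonneg hβ z x)]
      exact hB x
  have i1 : Integrable (fun x : Fin n → ℝ => (drift β z x).re ^ 2) μ :=
    iA.mono' ((Complex.continuous_re.comp
      (continuous_drift β hz0)).pow 2).aestronglyMeasurable (ae_of_all _ fun x => by
        rw [Real.norm_of_nonneg (sq_nonneg _), ← Complex.normSq_eq_norm_sq, Complex.normSq_apply]
        nlinarith [sq_nonneg (drift β z x).im])
  have i2 : Integrable (fun x : Fin n → ℝ => (drift β z x).im ^ 2) μ :=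
    iA.mono' ((Complex.continuous_im.comp
      (continuous_drift β hz0)).pow 2).aestronglyMeasurable (ae_of_all _ fun x => by
        rw [Real.norm_of_nonneg (sq_nonneg _), ← Complex.normSq_eq_norm_sq, Complex.normSq_apply]
        nlinarith [sq_nonneg (drift β z x).re])
  have hA : ∫ x, ‖drift β z x‖ ^ 2 ∂μ ≤ 8 * ∫ x, curvature β z x ∂μ := by
    have h1 := hμ.integral_drift_re_sq_le hβ hz0 (θ := 1) (by simp)
    have h2 := hμ.integral_drift_re_sq_le hβ hz0 (θ := -Complex.I) (by simp)
    have e : ∀ x : Fin n → ℝ, ‖drift β z x‖ ^ 2 = (drift β z x).re ^ 2 + (drift β z x).im ^ 2 :=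
      fun x => by
        rw [← Complex.normSq_eq_norm_sq, Complex.normSq_apply]
        ring
    simp only [one_mul, neg_mul, Complex.neg_re, Complex.I_mul_re, neg_neg] at h1 h2
    simp only [e]
    rw [integral_add i1 i2]
    linarith
  have hB2 : ∫ x, curvature β z x ∂μ
      ≤ 2 * (1 + β / 2) * (n ^ 4 / K ^ 2 * (∫ x, ‖stieltjes z x‖ ^ 2 ∂μ + 1)) := by
    have := integral_mono iB (((im.add (integrable_const (1 : ℝ))).const_mul _).const_mul _)
      (curvature_le hβ hK hn hKn hz)
    refine this.trans_eq ?_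
    simp only [Pi.add_apply]
    rw [integral_const_mul, integral_const_mul, integral_add im (integrable_const _)]
    simp
  have hpt : ∀ x : Fin n → ℝ, β ^ 2 / 4 * n ^ 4 * ‖defect z x‖ ^ 2
      ≤ 2 * ‖drift β z x‖ ^ 2
        + 2 * (1 + β / 2) ^ 2 * (n ^ 4 / K ^ 2 * (‖stieltjes z x‖ ^ 2 + 1)) := by
    intro x
    have hS0 := sqSum_nonneg z x
    have hS := sqSum_le_norm_stieltjes hK hn hz x
    have h1 : β / 2 * n ^ 2 * ‖defect z x‖ ≤ ‖drift β z x‖ + (1 + β / 2) * sqSum z x := by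
      have e : (β / 2 * n ^ 2 * defect z x : ℂ)
          = -drift β z x - (1 - β / 2) * ∑ j, resolvent1 z (x j) ^ 2 := by
        rw [drift]
        ring
      have e2 : β / 2 * n ^ 2 * ‖defect z x‖ = ‖(β / 2 * n ^ 2 * defect z x : ℂ)‖ := by
        simp [abs_of_pos hβ]
      rw [e2, e]
      refine (norm_sub_le _ _).trans ?_
      rw [norm_neg, norm_mul]
      gcongr
      · refine (norm_sub_le _ _).trans ?_
        simp [abs_of_pos hβ]
      · exact norm_sum_sq_le z x
    have h2 : sqSum z x ^ 2 ≤ n ^ 4 / K ^ 2 * (‖stieltjes z x‖ ^ 2 + 1) := by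
      refine (pow_le_pow_left₀ hS0 hS 2).trans ?_
      have : ((n : ℝ) ^ 2 * (‖stieltjes z x‖ / K)) ^ 2
        = n ^ 4 / K ^ 2 * ‖stieltjes z x‖ ^ 2 := by field_simp
      rw [this]
      gcongr
      linarith
    have h3 := pow_le_pow_left₀ (by positivity) h1 2
    have h4 := sq_nonneg (‖drift β z x‖ - (1 + β / 2) * sqSum z x)
    have h5 := mul_le_mul_of_nonneg_left h2 (by positivity : 0 ≤ 2 * (1 + β / 2) ^ 2)
    nlinarith
  have im1 : Integrable (fun x : Fin n → ℝ => 2 * (1 + β / 2) ^ 2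
      * (n ^ 4 / K ^ 2 * (‖stieltjes z x‖ ^ 2 + 1))) μ :=
    ((im.add (integrable_const (1 : ℝ))).const_mul _).const_mul _
  have hint := integral_mono (iD.const_mul _) ((iA.const_mul 2).add im1) hpt
  simp only [Pi.add_apply] at hint
  rw [integral_const_mul, integral_add (iA.const_mul 2) im1, integral_const_mul,
    integral_const_mul, integral_const_mul, integral_add im (integrable_const _)] at hint
  simp only [integral_const, probReal_univ, smul_eq_mul, one_mul] at hint
  set X := ∫ x, ‖stieltjes z x‖ ^ 2 ∂μ
  have hfin : β ^ 2 / 4 * n ^ 4 * ∫ x, ‖defect z x‖ ^ 2 ∂μ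
      ≤ (32 * (1 + β / 2) + 2 * (1 + β / 2) ^ 2) * (n ^ 4 / K ^ 2 * (X + 1)) := by linarith
  have : 0 < β ^ 2 / 4 * n ^ 4 := by positivity
  refine le_of_mul_le_mul_left (hfin.trans_eq ?_) this
  field_simp

/-- The empirical Stieltjes transform nearly solves the self-consistent equation, with high
probability, a large constant times the microscopic scale away from the real axis. -/
lemma exists_measure_defect_le {β ε : ℝ} (hβ : 0 < β) (hε : 0 < ε) :
    ∃ K₀ > 0, ∀ {n : ℕ} {μ : Measure (Fin n → ℝ)}, IsGaussianEnsemble β μ → ∀ {K : ℝ} {z : ℂ},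
      0 < n → K₀ ≤ K → K ≤ n → z.im = K / n → ‖z‖ ≤ 4 →
      μ.real {x | ε ≤ ‖defect z x‖} ≤ 1 / 4 := by
  obtain ⟨C, hC0, hC⟩ := exists_integral_defect_sq_le hβ
  refine ⟨√(2 * C) + √(160 * C / ε ^ 2), by positivity, ?_⟩
  intro n μ hμ K z hn hK hKn hz hz4
  have hp := hμ.1
  have hK0 : 0 < K := lt_of_lt_of_le (by positivity) hK
  have hn' : (0 : ℝ) < n := by exact_mod_cast hn
  have hz0 : 0 < z.im := by rw [hz]; positivity
  have iD := integrable_norm_sq μ (continuous_defect hz0) (norm_defect_le hz0)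
  have im := integrable_norm_sq μ (continuous_stieltjes hz0) (norm_stieltjes_le hz0)
  have hK1 : 2 * C ≤ K ^ 2 := by
    rw [← Real.sqrt_le_left hK0.le]
    exact (le_add_of_nonneg_right (Real.sqrt_nonneg _)).trans hK
  have hK2 : 160 * C / ε ^ 2 ≤ K ^ 2 := by
    rw [← Real.sqrt_le_left hK0.le]
    exact (le_add_of_nonneg_left (Real.sqrt_nonneg _)).trans hK
  have h1 := hC hμ hn hK0 hKn hz
  have h2 : ∫ x, ‖stieltjes z x‖ ^ 2 ∂μ ≤ ∫ x, ‖defect z x‖ ^ 2 ∂μ + 19 := by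
    have hpt : ∀ x : Fin n → ℝ, ‖stieltjes z x‖ ^ 2 ≤ ‖defect z x‖ ^ 2 + 19 := fun x => by
      have := norm_stieltjes_sq_le z x
      nlinarith [sq_nonneg (‖defect z x‖ - 1), norm_nonneg z]
    refine (integral_mono im (iD.add (integrable_const (19 : ℝ))) hpt).trans_eq ?_
    simp only [Pi.add_apply]
    rw [integral_add iD (integrable_const _)]
    simp
  set X := ∫ x, ‖defect z x‖ ^ 2 ∂μ with hX
  have hX0 : 0 ≤ X := integral_nonneg fun x => sq_nonneg _
  have h3 : X ≤ 40 * C / K ^ 2 := by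
    have h4 : X ≤ C / K ^ 2 * (X + 20) := h1.trans
      (mul_le_mul_of_nonneg_left (by linarith) (by positivity))
    rw [le_div_iff₀ (by positivity)]
    rw [div_mul_eq_mul_div, le_div_iff₀ (by positivity)] at h4
    nlinarith
  have h4 : X ≤ ε ^ 2 * (1 / 4) := by
    refine h3.trans ?_
    rw [div_le_iff₀ (by positivity)] at hK2 ⊢
    linarith
  have h5 := mul_meas_ge_le_integral_of_nonneg (μ := μ) (ae_of_all _ fun x => sq_nonneg _) iD
    (ε ^ 2)
  have h6 : {x : Fin n → ℝ | ε ≤ ‖defect z x‖} = {x | ε ^ 2 ≤ ‖defect z x‖ ^ 2} := by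
    ext x
    exact (pow_le_pow_iff_left₀ hε.le (norm_nonneg _) two_ne_zero).symm
  rw [h6]
  exact le_of_mul_le_mul_left (h5.trans h4) (by positivity)

lemma norm_resolvent1_sub_le {z : ℂ} (hz : 0 < z.im) {a b : ℝ} (hab : |a - b| ≤ z.im) :
    ‖resolvent1 z b - resolvent1 z a‖ ≤ 2 * z.im * ‖resolvent1 z a‖ ^ 2 := by
  have h : ‖resolvent1 z b - resolvent1 z a‖
      ≤ z.im * (‖resolvent1 z a‖ * ‖resolvent1 z b‖) := by
    rw [resolvent1_sub hz, norm_mul, norm_mul, Complex.norm_real, Real.norm_eq_abs,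
      mul_comm ‖resolvent1 z b‖]
    gcongr
  have h1 : ‖resolvent1 z b‖ ≤ 2 * ‖resolvent1 z a‖ := by
    have h2 := norm_sub_norm_le (resolvent1 z b) (resolvent1 z a)
    have h3 : z.im * (‖resolvent1 z a‖ * ‖resolvent1 z b‖)
        ≤ z.im * (‖resolvent1 z a‖ * z.im⁻¹) := by
      gcongr
      exact norm_resolvent1_le hz b
    have h4 : z.im * (‖resolvent1 z a‖ * z.im⁻¹) = ‖resolvent1 z a‖ := by field_simp
    linarith
  refine h.trans ?_
  calc z.im * (‖resolvent1 z a‖ * ‖resolvent1 z b‖)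
      ≤ z.im * (‖resolvent1 z a‖ * (2 * ‖resolvent1 z a‖)) := by gcongr
    _ = _ := by ring

lemma norm_stieltjes_le_of_abs_sub_le {n : ℕ} {z : ℂ} (hz : 0 < z.im) {x y : Fin n → ℝ}
    (hxy : ∀ i, |x i - y i| ≤ z.im) : ‖stieltjes z y‖ ≤ 3 * ‖stieltjes z x‖ := by
  rcases Nat.eq_zero_or_pos n with rfl | hn
  · simp [stieltjes]
  have hn' : (0 : ℝ) < n := by exact_mod_cast hn
  have h : ‖stieltjes z y - stieltjes z x‖ ≤ 2 * (stieltjes z x).im := by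
    rw [stieltjes, stieltjes, ← sub_div, norm_div, Complex.norm_natCast, div_le_iff₀ hn',
      ← Finset.sum_sub_distrib, ← stieltjes]
    have h1 := im_mul_sqSum z x
    calc ‖∑ j, (resolvent1 z (y j) - resolvent1 z (x j))‖
        ≤ ∑ j, 2 * z.im * ‖resolvent1 z (x j)‖ ^ 2 :=
          norm_sum_le_of_le _ fun j _ => norm_resolvent1_sub_le hz (hxy j)
      _ = 2 * (z.im * sqSum z x) := by rw [← Finset.mul_sum, sqSum]; ring
      _ = _ := by rw [h1]; ring
  have h1 := norm_sub_norm_le (stieltjes z y) (stieltjes z x)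
  have h2 := (le_abs_self _).trans (Complex.abs_im_le_norm (stieltjes z x))
  linarith

lemma norm_stieltjes_shift_le {n : ℕ} {z : ℂ} (hz : 0 < z.im) {a : ℝ} (ha : |a| ≤ z.im)
    (x : Fin n → ℝ) : ‖stieltjes (z + a) x‖ ≤ 3 * ‖stieltjes z x‖ := by
  have h : stieltjes (z + a) x = stieltjes z (fun i => x i - a) := by
    simp only [stieltjes, resolvent1]
    congr 1
    refine Finset.sum_congr rfl fun i _ => ?_
    congr 1
    push_cast
    ring
  rw [h]
  exact norm_stieltjes_le_of_abs_sub_le hz fun i => by simpa using ha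

lemma smallTime_unit (z : ℂ) : SmallTime z (z.im ^ 2 / 2) := ⟨by positivity, le_rfl⟩

/-- The flow run for the natural time at the scale of the imaginary part of `z`. -/
noncomputable def unitFlow {n : ℕ} (z θ : ℂ) (x : Fin n → ℝ) : Fin n → ℝ :=
  flowMap z θ (z.im ^ 2 / 2) x

lemma norm_stieltjes_unitFlow_le {n : ℕ} {z θ : ℂ} (hz : 0 < z.im) (hθ : ‖θ‖ ≤ 1)
    (x : Fin n → ℝ) : ‖stieltjes z (unitFlow z θ x)‖ ≤ 3 * ‖stieltjes z x‖ := by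
  refine norm_stieltjes_le_of_abs_sub_le hz fun i => ?_
  simp only [unitFlow, flowMap, flow]
  rw [sub_add_cancel_left, abs_neg, abs_mul, abs_of_nonneg (by positivity : 0 ≤ z.im ^ 2 / 2)]
  have h : |(θ * resolvent1 z (x i)).re| ≤ z.im⁻¹ := by
    refine (Complex.abs_re_le_norm _).trans ?_
    rw [norm_mul]
    exact (mul_le_of_le_one_left (norm_nonneg _) hθ).trans (norm_resolvent1_le hz _)
  calc z.im ^ 2 / 2 * |(θ * resolvent1 z (x i)).re| ≤ z.im ^ 2 / 2 * z.im⁻¹ := by gcongr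
    _ = z.im / 2 := by field_simp
    _ ≤ z.im := by linarith

/-- The unit flow distorts the ensemble by a bounded factor where the Stieltjes transform is
bounded. -/
lemma exists_mul_measure_le_measure_image {β K M : ℝ} (hβ : 0 < β) (hK : 0 < K) (hM : 0 < M) :
    ∃ c > 0, ∀ {n : ℕ} {μ : Measure (Fin n → ℝ)}, IsGaussianEnsemble β μ → ∀ {z θ : ℂ},
      0 < n → K ≤ n → z.im = K / n → ‖z‖ ≤ 4 → ‖θ‖ ≤ 1 → ∀ {s : Set (Fin n → ℝ)},
      MeasurableSet s → (∀ x ∈ s, ‖stieltjes z x‖ ≤ M) →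
      ENNReal.ofReal c * μ s ≤ μ (unitFlow z θ '' s) := by
  refine ⟨Real.exp (-(K ^ 2 / 2 * (β / 2 * (M ^ 2 + 4 * M + 1) + (1 + β / 2) * (M / K))
    + K ^ 2 * (1 + β / 2) * (M ^ 2 + 1) / 2)), Real.exp_pos _, ?_⟩
  intro n μ hμ z θ hn hKn hz hz4 hθ s hs hsM
  have hn' : (0 : ℝ) < n := by exact_mod_cast hn
  have hz0 : 0 < z.im := by rw [hz]; positivity
  refine le_trans ?_ (hμ.lintegral_exp_drift_le hβ (smallTime_unit z) hz0 hθ hs)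
  rw [← setLIntegral_const]
  refine setLIntegral_mono' hs fun x hx => ENNReal.ofReal_le_ofReal (Real.exp_le_exp.2 ?_)
  have hm := hsM x hx
  have hm0 := norm_nonneg (stieltjes z x)
  have h1 : ‖defect z x‖ ≤ M ^ 2 + 4 * M + 1 := by
    refine (norm_add₃_le).trans ?_
    rw [norm_pow, norm_mul, norm_one]
    gcongr
  have h2 : sqSum z x ≤ n ^ 2 * (M / K) :=
    (sqSum_le_norm_stieltjes hK hn hz x).trans (by gcongr)
  have h3 : ‖drift β z x‖ ≤ n ^ 2 * (β / 2 * (M ^ 2 + 4 * M + 1) + (1 + β / 2) * (M / K)) := by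
    have h4 : ‖(1 - β / 2 : ℂ)‖ ≤ 1 + β / 2 := by
      refine (norm_sub_le _ _).trans ?_
      simp [abs_of_pos hβ]
    have h5 : ‖(β / 2 * n ^ 2 : ℂ)‖ = β / 2 * n ^ 2 := by simp [abs_of_pos hβ]
    refine (norm_sub_le _ _).trans ?_
    rw [norm_neg, norm_mul, norm_mul (1 - (β : ℂ) / 2), h5]
    calc β / 2 * n ^ 2 * ‖defect z x‖ + ‖(1 - β / 2 : ℂ)‖ * ‖∑ j, resolvent1 z (x j) ^ 2‖
        ≤ β / 2 * n ^ 2 * (M ^ 2 + 4 * M + 1) + (1 + β / 2) * (n ^ 2 * (M / K)) := by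
          gcongr
          exact (norm_sum_sq_le z x).trans h2
      _ = _ := by ring
  have h4 : -‖drift β z x‖ ≤ (θ * drift β z x).re := by
    have := neg_abs_le (θ * drift β z x).re
    have h5 := Complex.abs_re_le_norm (θ * drift β z x)
    rw [norm_mul] at h5
    have h6 := mul_le_of_le_one_left (norm_nonneg (drift β z x)) hθ
    linarith
  have h5 := curvature_le hβ hK hn hKn hz x
  have h6 : z.im ^ 2 / 2 * ‖drift β z x‖
      ≤ K ^ 2 / 2 * (β / 2 * (M ^ 2 + 4 * M + 1) + (1 + β / 2) * (M / K)) := by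
    refine (mul_le_mul_of_nonneg_left h3 (by positivity)).trans_eq ?_
    rw [hz]
    field_simp
  have h7 : (z.im ^ 2 / 2) ^ 2 * curvature β z x ≤ K ^ 2 * (1 + β / 2) * (M ^ 2 + 1) / 2 := by
    calc (z.im ^ 2 / 2) ^ 2 * curvature β z x
        ≤ (z.im ^ 2 / 2) ^ 2 * (2 * (1 + β / 2) * (n ^ 4 / K ^ 2 * (M ^ 2 + 1))) := by
          refine mul_le_mul_of_nonneg_left (h5.trans ?_) (by positivity)
          gcongr
      _ = _ := by
          rw [hz]
          field_simp
  have h8 := mul_le_mul_of_nonneg_left h4 (by positivity : 0 ≤ z.im ^ 2 / 2)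
  linarith

/-- Iterating the unit flow along a chain of events. -/
lemma exists_mul_measure_le_of_chain {β K : ℝ} (hβ : 0 < β) (hK : 0 < K) (j : ℕ) :
    ∀ {M : ℝ}, 0 < M → ∃ c > 0, ∀ {n : ℕ} {μ : Measure (Fin n → ℝ)}, IsGaussianEnsemble β μ →
      ∀ {z θ : ℂ}, 0 < n → K ≤ n → z.im = K / n → ‖z‖ ≤ 4 → ‖θ‖ ≤ 1 →
      ∀ E : ℕ → Set (Fin n → ℝ), (∀ i, MeasurableSet (E i)) →
      (∀ i, ∀ x ∈ E i, unitFlow z θ x ∈ E (i + 1)) →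
      ENNReal.ofReal c * μ ({x | ‖stieltjes z x‖ ≤ M} ∩ E 0) ≤ μ (E j) := by
  induction j with
  | zero =>
    intro M _
    refine ⟨1, one_pos, ?_⟩
    intro n μ _ z θ _ _ _ _ _ E _ _
    rw [ENNReal.ofReal_one, one_mul]
    exact measure_mono Set.inter_subset_right
  | succ j ih =>
    intro M hM
    obtain ⟨c, hc, h⟩ := ih (by positivity : 0 < 3 * M)
    obtain ⟨c', hc', h'⟩ := exists_mul_measure_le_measure_image hβ hK hM
    refine ⟨c * c', by positivity, ?_⟩
    intro n μ hμ z θ hn hKn hz hz4 hθ E hE hflow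
    have hn' : (0 : ℝ) < n := by exact_mod_cast hn
    have hz0 : 0 < z.im := by rw [hz]; positivity
    have hmeas : MeasurableSet ({x : Fin n → ℝ | ‖stieltjes z x‖ ≤ M} ∩ E 0) :=
      (measurableSet_le (continuous_stieltjes hz0).norm.measurable measurable_const).inter (hE 0)
    calc ENNReal.ofReal (c * c') * μ ({x | ‖stieltjes z x‖ ≤ M} ∩ E 0)
        = ENNReal.ofReal c * (ENNReal.ofReal c' * μ ({x | ‖stieltjes z x‖ ≤ M} ∩ E 0)) := by
          rw [ENNReal.ofReal_mul hc.le, mul_assoc]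
      _ ≤ ENNReal.ofReal c * μ (unitFlow z θ '' ({x | ‖stieltjes z x‖ ≤ M} ∩ E 0)) := by
          gcongr
          exact h' hμ hn hKn hz hz4 hθ hmeas fun x hx => hx.1
      _ ≤ ENNReal.ofReal c * μ ({x | ‖stieltjes z x‖ ≤ 3 * M} ∩ E 1) := by
          gcongr
          rintro _ ⟨x, ⟨hx1, hx2⟩, rfl⟩
          refine ⟨(norm_stieltjes_unitFlow_le hz0 hθ x).trans ?_, hflow 0 x hx2⟩
          exact mul_le_mul_of_nonneg_left hx1 (by norm_num)
      _ ≤ μ (E (j + 1)) :=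
          h hμ hn hKn hz hz4 hθ (fun i => E (i + 1)) (fun i => hE _) fun i => hflow (i + 1)

lemma unitFlow_real_sub {n : ℕ} {z : ℂ} {K u : ℝ} (hK : 0 < K) (hn : 0 < n) (hre : z.re = u)
    (hz : z.im = K / n) (σ : ℝ) (x : Fin n → ℝ) (i : Fin n) :
    unitFlow z σ x i - u
      = (x i - u) * (1 + σ * (K ^ 2 / 2 / ((n * (x i - u)) ^ 2 + K ^ 2))) := by
  have hn' : (0 : ℝ) < n := by exact_mod_cast hn
  have h : (resolvent1 z (x i)).re = (x i - u) / ((x i - u) ^ 2 + (K / n) ^ 2) := by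
    rw [resolvent1, Complex.inv_re, Complex.normSq_apply]
    simp only [Complex.sub_re, Complex.ofReal_re, Complex.sub_im, Complex.ofReal_im, hre, hz]
    congr 1
    ring
  simp only [unitFlow, flowMap, flow]
  rw [Complex.re_ofReal_mul, h, hz]
  have : 0 < (x i - u) ^ 2 * n ^ 2 + K ^ 2 := by positivity
  field_simp
  ring

lemma im_stieltjes_eq {n : ℕ} {z : ℂ} {K u : ℝ} (hK : 0 < K) (hn : 0 < n) (hre : z.re = u)
    (hz : z.im = K / n) (x : Fin n → ℝ) :
    (stieltjes z x).im = ∑ j, K / ((n * (x j - u)) ^ 2 + K ^ 2) := by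
  have hn' : (0 : ℝ) < n := by exact_mod_cast hn
  rw [stieltjes, Complex.div_natCast_im, Complex.im_sum, Finset.sum_div]
  refine Finset.sum_congr rfl fun j _ => ?_
  rw [resolvent1, Complex.inv_im, Complex.normSq_apply]
  simp only [Complex.sub_re, Complex.ofReal_re, Complex.sub_im, Complex.ofReal_im, hre, hz]
  have h : (x j - u) * (x j - u) + (0 - K / n) * (0 - K / n)
      = ((n * (x j - u)) ^ 2 + K ^ 2) / n ^ 2 := by
    field_simp
    ring
  have h1 : 0 < (n * (x j - u)) ^ 2 + K ^ 2 := by positivity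
  rw [h]
  generalize (n * (x j - u)) ^ 2 + K ^ 2 = d at h1
  field_simp
  ring

lemma countIn_eq_sum (n : ℕ) (x : Fin n → ℝ) (I : Set ℝ) :
    (countIn n x I : ℝ) = ∑ j, I.indicator (fun _ => (1 : ℝ)) (x j) := by
  classical
  rw [countIn, Set.ncard_eq_toFinset_card', Finset.card_eq_sum_ones, Nat.cast_sum]
  simp only [Nat.cast_one, Set.toFinset_ofPred, Finset.sum_filter, Set.indicator]

lemma measurable_countIn (n : ℕ) {I : Set ℝ} (hI : MeasurableSet I) :
    Measurable fun x : Fin n → ℝ => (countIn n x I : ℝ) := by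
  simp only [countIn_eq_sum]
  refine Finset.measurable_sum _ fun j _ => ?_
  exact (measurable_const.indicator hI).comp (measurable_pi_apply j)

lemma countIn_le_countIn {n : ℕ} {x y : Fin n → ℝ} {I J : Set ℝ} (h : ∀ j, x j ∈ I → y j ∈ J) :
    countIn n x I ≤ countIn n y J :=
  Set.ncard_le_ncard (fun j hj => h j hj) (Set.toFinite _)

/-- The window of microscopic radius `r` about `u`. -/
def window (n : ℕ) (u r : ℝ) : Set ℝ := Set.Ioo (u - r / n) (u + r / n)

lemma mem_window {n : ℕ} (hn : 0 < n) {u r y : ℝ} : y ∈ window n u r ↔ n * |y - u| < r := by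
  have hn' : (0 : ℝ) < n := by exact_mod_cast hn
  rw [window, ← lt_div_iff₀' hn', abs_lt, Set.mem_Ioo]
  constructor <;> rintro ⟨h1, h2⟩ <;> constructor <;> linarith

lemma im_stieltjes_nonneg {n : ℕ} {z : ℂ} (hz : 0 < z.im) (x : Fin n → ℝ) :
    0 ≤ (stieltjes z x).im := by
  rcases Nat.eq_zero_or_pos n with rfl | hn
  · simp [stieltjes]
  have h := im_mul_sqSum z x
  have h0 := mul_nonneg hz.le (sqSum_nonneg z x)
  rw [h] at h0
  exact nonneg_of_mul_nonneg_right h0 (by exact_mod_cast hn)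

/-- In the bulk, a small defect forces a lower bound on the local density. -/
lemma half_le_im_stieltjes {n : ℕ} {z : ℂ} (hz : 0 < z.im) (hz2 : z.im ≤ 1 / 2)
    {x : Fin n → ℝ} (h : ‖defect z x‖ ≤ (1 - z.re ^ 2 / 4) / 2) :
    (1 - z.re ^ 2 / 4) / 2 ≤ (stieltjes z x).im := by
  have hs := im_stieltjes_nonneg hz x
  have h1 := (Complex.re_le_norm _).trans h
  simp only [defect, pow_two, Complex.add_re, Complex.mul_re, Complex.one_re] at h1
  by_contra! hc
  nlinarith [sq_nonneg ((stieltjes z x).re + z.re / 2), sq_nonneg z.re]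

lemma im_stieltjes_le_countIn {n : ℕ} {z w : ℂ} {K R u : ℝ} (hK : 0 < K) (hKR : K ≤ R)
    (hn : 0 < n) (hzre : z.re = u) (hz : z.im = K / n) (hwre : w.re = u) (hw : w.im = R / n)
    (x : Fin n → ℝ) :
    (stieltjes z x).im
      ≤ countIn n x (window n u R) / K + 2 * K / R * (stieltjes w x).im := by
  have hR := hK.trans_le hKR
  rw [im_stieltjes_eq hK hn hzre hz, im_stieltjes_eq hR hn hwre hw, countIn_eq_sum,
    Finset.sum_div, Finset.mul_sum, ← Finset.sum_add_distrib]
  refine Finset.sum_le_sum fun j _ => ?_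
  set d := n * (x j - u) with hd
  have hd' : |d| = n * |x j - u| := by rw [hd, abs_mul, Nat.abs_cast]
  have h0 : 0 ≤ 2 * K / R * (R / (d ^ 2 + R ^ 2)) := by positivity
  by_cases h : x j ∈ window n u R
  · rw [Set.indicator_of_mem h]
    have : K / (d ^ 2 + K ^ 2) ≤ 1 / K := by
      rw [div_le_div_iff₀ (by positivity) hK]
      nlinarith [sq_nonneg d]
    linarith
  · rw [Set.indicator_of_notMem h, zero_div, zero_add]
    rw [mem_window hn, ← hd', not_lt] at h
    have h1 : R ^ 2 ≤ d ^ 2 := sq_le_sq' (by linarith [abs_nonneg d]) h |>.trans_eq (sq_abs d)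
    have h2 : 2 * K / R * (R / (d ^ 2 + R ^ 2)) = 2 * K / (d ^ 2 + R ^ 2) := by field_simp
    rw [h2, div_le_div_iff₀ (by positivity) (by positivity)]
    nlinarith [sq_nonneg K]

lemma countIn_le_im_stieltjes {n : ℕ} {z : ℂ} {K u : ℝ} (hK : 0 < K) (hn : 0 < n)
    (hre : z.re = u) (hz : z.im = K / n) (x : Fin n → ℝ) :
    (countIn n x (window n u K) : ℝ) ≤ 2 * K * (stieltjes z x).im := by
  rw [im_stieltjes_eq hK hn hre hz, countIn_eq_sum, Finset.mul_sum]
  refine Finset.sum_le_sum fun j _ => ?_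
  by_cases h : x j ∈ window n u K
  · rw [Set.indicator_of_mem h]
    rw [mem_window hn] at h
    have h1 : (n * (x j - u)) ^ 2 ≤ K ^ 2 := by
      rw [← sq_abs, abs_mul, Nat.abs_cast]
      exact pow_le_pow_left₀ (by positivity) h.le 2
    rw [← mul_div_assoc, le_div_iff₀ (by positivity)]
    nlinarith
  · rw [Set.indicator_of_notMem h]
    positivity

lemma norm_stieltjes_le_five {n : ℕ} {z : ℂ} {x : Fin n → ℝ} (hz : ‖z‖ ≤ 4)
    (h : ‖defect z x‖ ≤ 1) : ‖stieltjes z x‖ ≤ 5 := by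
  have h1 := norm_stieltjes_sq_le z x
  nlinarith [norm_nonneg z]

lemma norm_mk_le_four {u η : ℝ} (hu : |u| ≤ 3) (hη : |η| ≤ 1) : ‖(⟨u, η⟩ : ℂ)‖ ≤ 4 := by
  have h := Complex.norm_le_abs_re_add_abs_im (⟨u, η⟩ : ℂ)
  simp only at h
  linarith

/-- With positive probability many points lie in a large microscopic window. -/
lemma exists_half_le_measure_countIn {β x₀ : ℝ} (hβ : 0 < β) (hx₀ : x₀ ∈ Set.Ioo (-2 : ℝ) 2)
    (k : ℕ) :
    ∃ K > (0 : ℝ), ∃ R > (0 : ℝ), ∀ {n : ℕ} {μ : Measure (Fin n → ℝ)}, IsGaussianEnsemble β μ →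
      2 * R ≤ n → K ≤ n ∧ 1 / 2 ≤ μ.real ({x | ‖stieltjes ⟨x₀, K / n⟩ x‖ ≤ 5} ∩
        {x | k ≤ countIn n x (window n x₀ R)}) := by
  set c := 1 - x₀ ^ 2 / 4 with hc
  have hc0 : 0 < c := by
    have := mul_pos (sub_pos.2 hx₀.1) (sub_pos.2 hx₀.2)
    nlinarith
  have hc1 : c ≤ 1 := by linarith [sq_nonneg x₀]
  obtain ⟨K₀, hK₀, h⟩ := exists_measure_defect_le hβ (half_pos hc0)
  have hK : 0 < K₀ + 4 * k / c := by positivity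
  have hkK : k ≤ (K₀ + 4 * k / c) * (c / 4) := by
    have : (K₀ + 4 * k / c) * (c / 4) = K₀ * (c / 4) + k := by field_simp
    rw [this]
    have : 0 < K₀ * (c / 4) := by positivity
    linarith
  have hK₀K : K₀ ≤ K₀ + 4 * k / c := le_add_of_nonneg_right (by positivity)
  generalize K₀ + 4 * k / c = K at *
  obtain ⟨R, hR⟩ : ∃ R, R = 40 * K / c := ⟨_, rfl⟩
  have hKR : K ≤ R := by
    rw [hR, le_div_iff₀ hc0]
    nlinarith
  have hR0 := hK.trans_le hKR
  refine ⟨K, hK, R, hR0, ?_⟩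
  intro n μ hμ hRn
  have hn' : (0 : ℝ) < n := by linarith
  have hn : 0 < n := by exact_mod_cast hn'
  have hp := hμ.1
  have hx3 : |x₀| ≤ 3 := abs_le.2 ⟨by linarith [hx₀.1], by linarith [hx₀.2]⟩
  have hRn2 : R / n ≤ 1 / 2 := by
    rw [div_le_iff₀ hn']
    linarith
  have hKn2 : K / n ≤ 1 / 2 := (by gcongr : K / n ≤ R / n).trans hRn2
  have hKn0 : 0 < K / n := by positivity
  have hRn0 : 0 < R / n := by positivity
  have hz4 : ‖(⟨x₀, K / n⟩ : ℂ)‖ ≤ 4 :=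
    norm_mk_le_four hx3 (abs_le.2 ⟨by linarith, by linarith⟩)
  have hw4 : ‖(⟨x₀, R / n⟩ : ℂ)‖ ≤ 4 :=
    norm_mk_le_four hx3 (abs_le.2 ⟨by linarith, by linarith⟩)
  refine ⟨by linarith, ?_⟩
  have h1 := h hμ (K := K) (z := ⟨x₀, K / n⟩) hn hK₀K (by linarith) rfl hz4
  have h2 := h hμ (K := R) (z := ⟨x₀, R / n⟩) hn (by linarith) (by linarith) rfl hw4
  set G := {x : Fin n → ℝ | ‖stieltjes ⟨x₀, K / n⟩ x‖ ≤ 5} ∩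
        {x | k ≤ countIn n x (window n x₀ R)} with hG
  set A := {x : Fin n → ℝ | c / 2 ≤ ‖defect ⟨x₀, K / n⟩ x‖}
  set B := {x : Fin n → ℝ | c / 2 ≤ ‖defect ⟨x₀, R / n⟩ x‖}
  have hcover : Set.univ ⊆ G ∪ (A ∪ B) := by
    intro x _
    by_cases hA : x ∈ A
    · exact Or.inr (Or.inl hA)
    by_cases hB : x ∈ B
    · exact Or.inr (Or.inr hB)
    left
    replace hA : ‖defect ⟨x₀, K / n⟩ x‖ < c / 2 := not_le.1 hA
    replace hB : ‖defect ⟨x₀, R / n⟩ x‖ < c / 2 := not_le.1 hB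
    refine ⟨norm_stieltjes_le_five hz4 (by linarith), ?_⟩
    have h3 := half_le_im_stieltjes (z := ⟨x₀, K / n⟩) hKn0 hKn2 (x := x) hA.le
    have h4 := (Complex.abs_im_le_norm _).trans (norm_stieltjes_le_five hw4 (by linarith) (x := x))
    have h5 := im_stieltjes_le_countIn hK hKR hn (z := ⟨x₀, K / n⟩) (w := ⟨x₀, R / n⟩) rfl rfl rfl
      rfl x
    have h6 : 2 * K / R * (stieltjes ⟨x₀, R / n⟩ x).im ≤ c / 4 := by
      calc 2 * K / R * (stieltjes ⟨x₀, R / n⟩ x).im ≤ 2 * K / R * 5 := by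
            gcongr
            exact (le_abs_self _).trans h4
        _ = c / 4 := by
            rw [hR]
            field_simp
            norm_num
    have h7 : c / 4 ≤ countIn n x (window n x₀ R) / K := by
      change c / 2 ≤ _ at h3
      linarith
    rw [le_div_iff₀ hK] at h7
    have h8 : (k : ℝ) ≤ countIn n x (window n x₀ R) := by linarith
    exact_mod_cast h8
  have h3 := measureReal_mono (μ := μ) hcover
  rw [probReal_univ] at h3
  have h4 := measureReal_union_le (μ := μ) G (A ∪ B)
  have h5 := measureReal_union_le (μ := μ) A B
  linarith

lemma unitFlow_contract {n : ℕ} {z : ℂ} {K R r u : ℝ} (hK : 0 < K) (hrR : r ≤ R)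
    (hn : 0 < n) (hre : z.re = u) (hz : z.im = K / n) {x : Fin n → ℝ} {j : Fin n}
    (h : x j ∈ window n u r) :
    unitFlow z (-1) x j ∈ window n u ((1 - K ^ 2 / 2 / (R ^ 2 + K ^ 2)) * r) := by
  have hn' : (0 : ℝ) < n := by exact_mod_cast hn
  rw [mem_window hn] at h ⊢
  have h1 := unitFlow_real_sub hK hn hre hz (-1) x j
  rw [Complex.ofReal_neg, Complex.ofReal_one] at h1
  have h0 : 0 ≤ n * |x j - u| := by positivity
  have h2 : (n * (x j - u)) ^ 2 ≤ R ^ 2 := by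
    rw [← sq_abs, abs_mul, Nat.abs_cast]
    exact pow_le_pow_left₀ h0 (by linarith) 2
  have h3 : K ^ 2 / 2 / (R ^ 2 + K ^ 2) ≤ K ^ 2 / 2 / ((n * (x j - u)) ^ 2 + K ^ 2) := by
    gcongr
  have h4 : K ^ 2 / 2 / ((n * (x j - u)) ^ 2 + K ^ 2) ≤ 1 / 2 := by
    rw [div_le_div_iff₀ (by positivity) (by norm_num)]
    nlinarith [sq_nonneg (n * (x j - u))]
  rw [h1, abs_mul, abs_of_nonneg (a := 1 + _) (by linarith), ← mul_assoc, mul_comm]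
  calc (1 + -1 * (K ^ 2 / 2 / ((n * (x j - u)) ^ 2 + K ^ 2))) * (n * |x j - u|)
      ≤ (1 - K ^ 2 / 2 / (R ^ 2 + K ^ 2)) * (n * |x j - u|) := by
        gcongr
        linarith
    _ < _ := by
        gcongr
        linarith

/-- With probability bounded below, many points lie in a given microscopic window. -/
lemma exists_le_measure_le_countIn {β x₀ L : ℝ} (hβ : 0 < β) (hx₀ : x₀ ∈ Set.Ioo (-2 : ℝ) 2)
    (hL : 0 < L) (k : ℕ) :
    ∃ c > 0, ∃ N : ℕ, ∀ {n : ℕ} {μ : Measure (Fin n → ℝ)}, IsGaussianEnsemble β μ → N ≤ n →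
      ENNReal.ofReal c ≤ μ {x | k ≤ countIn n x (window n x₀ L)} := by
  obtain ⟨K, hK, R, hR, h⟩ := exists_half_le_measure_countIn hβ hx₀ k
  set κ := 1 - K ^ 2 / 2 / (R ^ 2 + K ^ 2) with hκ
  have hκ0 : 0 ≤ κ := by
    rw [hκ, sub_nonneg, div_le_one (by positivity)]
    nlinarith [sq_nonneg R, sq_nonneg K]
  have hκ1 : κ < 1 := sub_lt_self _ (by positivity)
  obtain ⟨j, hj⟩ := exists_pow_lt_of_lt_one (div_pos hL hR) hκ1
  rw [lt_div_iff₀ hR] at hj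
  obtain ⟨c, hc, hchain⟩ := exists_mul_measure_le_of_chain hβ hK j (by norm_num : (0 : ℝ) < 5)
  refine ⟨c * (1 / 2), by positivity, ⌈2 * R⌉₊, ?_⟩
  intro n μ hμ hNn
  have hRn : 2 * R ≤ n := Nat.ceil_le.1 hNn
  have hn' : (0 : ℝ) < n := by linarith
  have hn : 0 < n := by exact_mod_cast hn'
  have hp := hμ.1
  obtain ⟨hKn, hhalf⟩ := h hμ hRn
  have hx3 : |x₀| ≤ 3 := abs_le.2 ⟨by linarith [hx₀.1], by linarith [hx₀.2]⟩
  have hz4 : ‖(⟨x₀, K / n⟩ : ℂ)‖ ≤ 4 := by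
    refine norm_mk_le_four hx3 ?_
    rw [abs_of_nonneg (by positivity)]
    exact (div_le_one hn').2 hKn
  have hstep := hchain hμ (z := ⟨x₀, K / n⟩) (θ := -1) hn hKn rfl hz4 (by simp)
    (fun i => {x | k ≤ countIn n x (window n x₀ (κ ^ i * R))})
    (fun i => by
      have : {x : Fin n → ℝ | k ≤ countIn n x (window n x₀ (κ ^ i * R))}
          = {x | (k : ℝ) ≤ countIn n x (window n x₀ (κ ^ i * R))} := by
        ext x
        simp
      rw [this]
      exact measurableSet_le measurable_const (measurable_countIn n measurableSet_Ioo))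
    (fun i x hx => by
      refine le_trans hx (countIn_le_countIn fun j hj => ?_)
      rw [pow_succ', mul_assoc]
      exact unitFlow_contract (z := ⟨x₀, K / n⟩) hK
        (mul_le_of_le_one_left hR.le (pow_le_one₀ hκ0 hκ1.le)) hn rfl rfl hj)
  rw [ENNReal.ofReal_mul hc.le]
  refine le_trans ?_ (hstep.trans (measure_mono fun x hx => ?_))
  · gcongr
    simp only [pow_zero, one_mul]
    exact ENNReal.ofReal_le_of_le_toReal hhalf
  · refine le_trans hx (countIn_le_countIn fun i hi => ?_)
    rw [mem_window hn] at hi ⊢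
    exact hi.trans hj

lemma unitFlow_expand {n : ℕ} {z : ℂ} {K R r u : ℝ} (hK : 0 < K) (hR : 0 < R)
    (hn : 0 < n) (hre : z.re = u) (hz : z.im = K / n) {x : Fin n → ℝ} {j : Fin n}
    (h : min r R ≤ n * |x j - u|) :
    min ((1 + K ^ 2 / 2 / (R ^ 2 + K ^ 2)) * r) R ≤ n * |unitFlow z 1 x j - u| := by
  have h1 := unitFlow_real_sub hK hn hre hz 1 x j
  rw [Complex.ofReal_one, one_mul] at h1
  have h0 : 0 ≤ n * |x j - u| := by positivity
  have h2 : 0 ≤ K ^ 2 / 2 / ((n * (x j - u)) ^ 2 + K ^ 2) := by positivity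
  rw [h1, abs_mul, abs_of_nonneg (a := 1 + _) (by linarith), ← mul_assoc]
  rcases le_or_gt R (n * |x j - u|) with hc | hc
  · exact (min_le_right _ _).trans
      (hc.trans (le_mul_of_one_le_right h0 (by linarith)))
  · have h3 : r ≤ n * |x j - u| := (min_le_iff.1 h).resolve_right hc.not_ge
    refine (min_le_left _ _).trans ?_
    have h4 : (n * (x j - u)) ^ 2 ≤ R ^ 2 := by
      rw [← sq_abs, abs_mul, Nat.abs_cast]
      exact pow_le_pow_left₀ h0 hc.le 2
    rw [mul_comm]
    gcongr

lemma exists_forall_le_of_countIn_lt {n M : ℕ} (hn : 0 < n) {u ε : ℝ} (hε : 0 < ε)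
    {x : Fin n → ℝ} (h : countIn n x (window n u (2 * M * ε)) < M) :
    ∃ l < M, ∀ j, ε ≤ n * |x j - (u + (2 * l + 1) * ε / n)| := by
  have hn' : (0 : ℝ) < n := by exact_mod_cast hn
  have : Nonempty (Fin n) := ⟨⟨0, hn⟩⟩
  by_contra! hc
  choose! f hf using hc
  refine h.not_ge ?_
  have hinj : Set.InjOn f (Finset.range M) := by
    intro a ha b hb hab
    have h1 := hf a (Finset.mem_range.1 ha)
    have h2 := hf b (Finset.mem_range.1 hb)
    rw [← hab] at h2
    have h3 := abs_sub_le (u + (2 * a + 1) * ε / n) (x (f a)) (u + (2 * b + 1) * ε / n)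
    rw [abs_sub_comm _ (x (f a))] at h3
    have h4 : u + (2 * a + 1) * ε / n - (u + (2 * b + 1) * ε / n)
        = 2 * ε / n * ((a : ℝ) - b) := by ring
    rw [h4, abs_mul, abs_of_pos (by positivity : 0 < 2 * ε / n)] at h3
    have h5 : n * (2 * ε / n * |(a : ℝ) - b|) < 2 * ε := by
      refine (mul_le_mul_of_nonneg_left h3 hn'.le).trans_lt ?_
      rw [mul_add]
      linarith
    have h6 : n * (2 * ε / n * |(a : ℝ) - b|) = 2 * ε * |(a : ℝ) - b| := by field_simp
    rw [h6, mul_lt_iff_lt_one_right (by positivity)] at h5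
    have h7 : |(a : ℤ) - b| < 1 := by exact_mod_cast h5
    rw [Int.abs_lt_one_iff] at h7
    omega
  have hsub : f '' (Finset.range M) ⊆ {j | x j ∈ window n u (2 * M * ε)} := by
    rintro _ ⟨l, hl, rfl⟩
    have hl' : l < M := Finset.mem_range.1 hl
    have h1 := hf l hl'
    refine (mem_window hn).2 ?_
    have h2 := abs_sub_le (x (f l)) (u + (2 * l + 1) * ε / n) u
    rw [add_sub_cancel_left, abs_of_pos (by positivity : 0 < (2 * l + 1) * ε / n)] at h2
    have h3 : n * ((2 * l + 1) * ε / n) = (2 * l + 1) * ε := by field_simp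
    have h4 : (l : ℝ) + 1 ≤ M := by exact_mod_cast hl'
    have h5 := mul_le_mul_of_nonneg_left h2 hn'.le
    rw [mul_add, h3] at h5
    nlinarith
  have h1 := Set.ncard_le_ncard hsub (Set.toFinite _)
  rwa [hinj.ncard_image, Set.ncard_coe_finset, Finset.card_range] at h1

/-- With positive probability, one of finitely many microscopic windows is empty. -/
lemma exists_le_measure_hole {β x₀ : ℝ} (hβ : 0 < β) (hx₀ : |x₀| ≤ 2) :
    ∃ K > (0 : ℝ), ∃ ε > (0 : ℝ), ∃ p > (0 : ℝ), ∀ {n : ℕ} {μ : Measure (Fin n → ℝ)},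
      IsGaussianEnsemble β μ → 0 < n → K ≤ n → ∃ a, 0 ≤ a ∧ a ≤ K ∧
        p ≤ μ.real ({x | ‖stieltjes ⟨x₀ + a / n, K / n⟩ x‖ ≤ 15} ∩
          {x | ∀ j, ε ≤ n * |x j - (x₀ + a / n)|}) := by
  obtain ⟨K, hK, h⟩ := exists_measure_defect_le hβ one_pos
  obtain ⟨M, hM⟩ := exists_nat_gt (10 * K)
  have hM0 : (0 : ℝ) < M := by linarith
  obtain ⟨ε, hε⟩ : ∃ ε, ε = K / (2 * M) := ⟨_, rfl⟩
  have hMε : 2 * M * ε = K := by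
    rw [hε]
    field_simp
  have hε0 : 0 < ε := by rw [hε]; positivity
  refine ⟨K, hK, ε, hε0, 3 / 4 / M, by positivity, ?_⟩
  intro n μ hμ hn hKn
  have hn' : (0 : ℝ) < n := by exact_mod_cast hn
  have hp := hμ.1
  have hKn1 : K / n ≤ 1 := (div_le_one hn').2 hKn
  have hKn0 : 0 < K / n := by positivity
  have hz4 : ‖(⟨x₀, K / n⟩ : ℂ)‖ ≤ 4 :=
    norm_mk_le_four (by linarith) (by rwa [abs_of_pos hKn0])
  have h1 := h hμ (K := K) (z := ⟨x₀, K / n⟩) hn le_rfl hKn rfl hz4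
  set G : ℕ → Set (Fin n → ℝ) := fun l =>
    {x | ‖stieltjes ⟨x₀ + (2 * l + 1) * ε / n, K / n⟩ x‖ ≤ 15} ∩
      {x | ∀ j, ε ≤ n * |x j - (x₀ + (2 * l + 1) * ε / n)|} with hG
  have hl : ∀ l < M, (2 * (l : ℝ) + 1) * ε ≤ K := by
    intro l hl
    have : (l : ℝ) + 1 ≤ M := by exact_mod_cast hl
    rw [← hMε]
    gcongr
    linarith
  set A := {x : Fin n → ℝ | 1 ≤ ‖defect ⟨x₀, K / n⟩ x‖}
  have hcover : Set.univ ⊆ A ∪ ⋃ l ∈ Finset.range M, G l := by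
    intro x _
    by_cases hA : x ∈ A
    · exact Or.inl hA
    right
    replace hA : ‖defect ⟨x₀, K / n⟩ x‖ < 1 := not_le.1 hA
    have h5 := norm_stieltjes_le_five hz4 hA.le
    have hcount : countIn n x (window n x₀ (2 * M * ε)) < M := by
      rw [hMε]
      have h2 := countIn_le_im_stieltjes hK hn (z := ⟨x₀, K / n⟩) rfl rfl x
      have h3 := (le_abs_self _).trans ((Complex.abs_im_le_norm _).trans h5)
      have : (countIn n x (window n x₀ K) : ℝ) < M := by nlinarith
      exact_mod_cast this
    obtain ⟨l, hlM, hhole⟩ := exists_forall_le_of_countIn_lt hn hε0 hcount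
    refine Set.mem_biUnion (Finset.mem_coe.2 (Finset.mem_range.2 hlM)) ⟨?_, hhole⟩
    have h6 := norm_stieltjes_shift_le (z := ⟨x₀, K / n⟩) (a := (2 * l + 1) * ε / n) hKn0 (by
      rw [abs_of_pos (by positivity)]
      exact div_le_div_of_nonneg_right (hl l hlM) hn'.le) x
    have h7 : (⟨x₀, K / n⟩ : ℂ) + ((2 * l + 1) * ε / n : ℝ)
        = ⟨x₀ + (2 * l + 1) * ε / n, K / n⟩ := by
      apply Complex.ext <;> simp
    rw [h7] at h6
    exact h6.trans (by linarith)
  have h2 := measureReal_mono (μ := μ) hcover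
  rw [probReal_univ] at h2
  have h3 := measureReal_union_le (μ := μ) A (⋃ l ∈ Finset.range M, G l)
  have h4 := measureReal_biUnion_finset_le (μ := μ) (Finset.range M) G
  have hMne : (Finset.range M).Nonempty := Finset.nonempty_range_iff.2 (by
    rintro rfl
    simp at hM0)
  obtain ⟨l, hlM, hle⟩ := Finset.exists_le_of_sum_le (s := Finset.range M)
    (f := fun _ => 3 / 4 / (M : ℝ)) (g := fun l => μ.real (G l)) hMne (by
      rw [Finset.sum_const, Finset.card_range, nsmul_eq_mul, mul_div_cancel₀ _ hM0.ne']
      linarith)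
  exact ⟨(2 * l + 1) * ε, by positivity, hl l (Finset.mem_range.1 hlM), hle⟩

/-- With probability bounded below, a given microscopic window is empty. -/
lemma exists_le_measure_countIn_eq_zero {β x₀ : ℝ} (hβ : 0 < β) (hx₀ : x₀ ∈ Set.Ioo (-2 : ℝ) 2)
    {L : ℝ} (hL : 0 < L) :
    ∃ c > 0, ∃ N : ℕ, ∀ {n : ℕ} {μ : Measure (Fin n → ℝ)}, IsGaussianEnsemble β μ → N ≤ n →
      ENNReal.ofReal c ≤ μ {x | countIn n x (window n x₀ L) = 0} := by
  have hx2 : |x₀| ≤ 2 := abs_le.2 ⟨hx₀.1.le, hx₀.2.le⟩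
  obtain ⟨K, hK, ε, hε, p, hp0, h⟩ := exists_le_measure_hole hβ hx2
  obtain ⟨R, hR⟩ : ∃ R, R = L + K := ⟨_, rfl⟩
  have hR0 : 0 < R := by linarith
  set κ := 1 + K ^ 2 / 2 / (R ^ 2 + K ^ 2) with hκ
  have hκ1 : 1 < κ := lt_add_of_pos_right _ (by positivity)
  obtain ⟨j, hj⟩ := pow_unbounded_of_one_lt (R / ε) hκ1
  rw [div_lt_iff₀ hε] at hj
  obtain ⟨c, hc, hchain⟩ := exists_mul_measure_le_of_chain hβ hK j (by norm_num : (0 : ℝ) < 15)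
  refine ⟨c * p, by positivity, ⌈K⌉₊, ?_⟩
  intro n μ hμ hNn
  have hKn : K ≤ n := Nat.ceil_le.1 hNn
  have hn' : (0 : ℝ) < n := by linarith
  have hn : 0 < n := by exact_mod_cast hn'
  have hp := hμ.1
  obtain ⟨a, ha0, haK, hhole⟩ := h hμ hn hKn
  have hKn1 : K / n ≤ 1 := (div_le_one hn').2 hKn
  have han1 : |a / n| ≤ 1 := by
    rw [abs_of_nonneg (by positivity)]
    exact (by gcongr : a / n ≤ K / n).trans hKn1
  have hz4 : ‖(⟨x₀ + a / n, K / n⟩ : ℂ)‖ ≤ 4 :=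
    norm_mk_le_four ((abs_add_le _ _).trans (by linarith))
      (by rwa [abs_of_nonneg (by positivity)])
  have hstep := hchain hμ (z := ⟨x₀ + a / n, K / n⟩) (θ := 1) hn hKn rfl hz4 (by simp)
    (fun i => {x | ∀ j, min (κ ^ i * ε) R ≤ n * |x j - (x₀ + a / n)|})
    (fun i => by
      rw [Set.ofPred_forall]
      refine MeasurableSet.iInter fun j => measurableSet_le measurable_const ?_
      fun_prop)
    (fun i x hx j => by
      rw [pow_succ', mul_assoc]
      exact unitFlow_expand hK hR0 hn rfl rfl (hx j))
  rw [ENNReal.ofReal_mul hc.le]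
  refine le_trans ?_ (hstep.trans (measure_mono fun x hx => ?_))
  · gcongr
    refine (ENNReal.ofReal_le_of_le_toReal hhole).trans (measure_mono ?_)
    rintro x ⟨hx1, hx2⟩
    refine ⟨hx1, fun j => ?_⟩
    rw [pow_zero, one_mul]
    exact (min_le_left _ _).trans (hx2 j)
  · have hempty : {i : Fin n | x i ∈ window n x₀ L} = ∅ := by
      refine Set.eq_empty_of_forall_notMem fun i hi => ?_
      have h1 := (mem_window hn).1 hi
      have h2 := hx i
      rw [min_eq_right hj.le, hR] at h2
      have h3 : |x i - (x₀ + a / n)| ≤ |x i - x₀| + a / n := by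
        rw [← sub_sub]
        refine (abs_sub _ _).trans ?_
        rw [abs_of_nonneg (by positivity : 0 ≤ a / n)]
      have h4 := mul_le_mul_of_nonneg_left h3 hn'.le
      rw [mul_add, mul_div_cancel₀ _ hn'.ne'] at h4
      linarith
    change countIn n x (window n x₀ L) = 0
    rw [countIn, hempty, Set.ncard_empty]

/-- The second Borel-Cantelli lemma for coordinate events with probabilities bounded below. -/
lemma ae_frequently_mem {X : ℕ → Type*} [∀ n, MeasurableSpace (X n)]
    {μ : (n : ℕ) → Measure (X n)} [∀ n, IsProbabilityMeasure (μ n)]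
    {P : Measure ((n : ℕ) → X n)} [IsProbabilityMeasure P]
    (hP : ∀ (S : Finset ℕ) (A : (n : ℕ) → Set (X n)), (∀ n ∈ S, MeasurableSet (A n)) →
      P {ω | ∀ n ∈ S, ω n ∈ A n} = ∏ n ∈ S, μ n (A n))
    {A : (n : ℕ) → Set (X n)} (hA : ∀ n, MeasurableSet (A n)) {c : ℝ} (hc : 0 < c) {N : ℕ}
    (h : ∀ n, N ≤ n → ENNReal.ofReal c ≤ μ n (A n)) :
    ∀ᵐ ω ∂P, ∃ᶠ n in atTop, ω n ∈ A n := by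
  simp only [frequently_atTop]
  refine ae_all_iff.2 fun m => ?_
  rw [ae_iff]
  simp only [not_exists, not_and]
  have hlt : 1 - ENNReal.ofReal c < 1 :=
    ENNReal.sub_lt_self ENNReal.one_ne_top one_ne_zero (ENNReal.ofReal_pos.2 hc).ne'
  refine le_antisymm (ge_of_tendsto' (ENNReal.tendsto_pow_atTop_nhds_zero_of_lt_one hlt)
    fun r => ?_) zero_le
  calc P {ω | ∀ n, m ≤ n → ω n ∉ A n}
      ≤ P {ω | ∀ n ∈ Finset.Ico (m + N) (m + N + r), ω n ∈ (A n)ᶜ} := by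
        refine measure_mono fun ω hω n hn => hω n ?_
        have := (Finset.mem_Ico.1 hn).1
        omega
    _ = ∏ n ∈ Finset.Ico (m + N) (m + N + r), μ n (A n)ᶜ := hP _ _ fun n _ => (hA n).compl
    _ ≤ ∏ _n ∈ Finset.Ico (m + N) (m + N + r), (1 - ENNReal.ofReal c) := by
        refine Finset.prod_le_prod' fun n hn => ?_
        rw [prob_compl_eq_one_sub (hA n)]
        exact tsub_le_tsub_left (h n (by have := (Finset.mem_Ico.1 hn).1; omega)) _
    _ = (1 - ENNReal.ofReal c) ^ r := by
        rw [Finset.prod_const, Nat.card_Ico, Nat.add_sub_cancel_left]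

lemma limsup_natCast_eq_top {u : ℕ → ℕ} (h : ∀ k, ∃ᶠ n in atTop, k ≤ u n) :
    limsup (fun n => (u n : ℝ≥0∞)) atTop = ⊤ := by
  refine ENNReal.eq_top_of_forall_nnreal_le fun r => ?_
  obtain ⟨k, hk⟩ := exists_nat_ge r
  refine le_limsup_of_frequently_le ((h k).mono fun n hn => ?_)
  exact (by exact_mod_cast hk : (r : ℝ≥0∞) ≤ k).trans (by exact_mod_cast hn)

lemma liminf_natCast_eq_zero {u : ℕ → ℕ} (h : ∃ᶠ n in atTop, u n = 0) :
    liminf (fun n => (u n : ℝ≥0∞)) atTop = 0 :=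
  le_antisymm (liminf_le_of_frequently_le (h.mono fun n hn => by simp [hn])) zero_le

lemma window_subset_window (n : ℕ) (u : ℝ) {r s : ℝ} (h : r ≤ s) :
    window n u r ⊆ window n u s := by
  have : r / n ≤ s / n := by gcongr
  exact Set.Ioo_subset_Ioo (by linarith) (by linarith)

/-- At fixed inverse temperature, microscopic bulk Beurling-Landau densities do not exist. -/
theorem bulk_no_equidistribution_fixed_beta
    (β₀ : ℝ) (hβ₀ : 0 < β₀) (β : ℕ → ℝ) (hβ : ∀ n, β n = β₀)
    (Z : ℕ → ℝ) (hZ : ∀ n, 0 < Z n)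
    (μ : (n : ℕ) → Measure (Fin n → ℝ))
    (hμ : ∀ n, μ n =
      volume.withDensity (fun x => ENNReal.ofReal (gaussianDensity n (β n) x / Z n)))
    (hμprob : ∀ n, IsProbabilityMeasure (μ n))
    (P : Measure ((n : ℕ) → Fin n → ℝ)) (hPprob : IsProbabilityMeasure P)
    (hP : ∀ (S : Finset ℕ) (A : (n : ℕ) → Set (Fin n → ℝ)),
      (∀ n ∈ S, MeasurableSet (A n)) →
      P {ω | ∀ n ∈ S, ω n ∈ A n} = ∏ n ∈ S, μ n (A n))
    (x : ℝ) (hx : x ∈ Set.Ioo (-2 : ℝ) 2) :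
    ∀ᵐ ω ∂P, ∀ L : ℝ, 0 < L →
      Filter.limsup
        (fun n : ℕ => (countIn n (ω n) (Set.Ioo (x - L / n) (x + L / n)) : ℝ≥0∞))
        atTop = ⊤ ∧
      Filter.liminf
        (fun n : ℕ => (countIn n (ω n) (Set.Ioo (x - L / n) (x + L / n)) : ℝ≥0∞))
        atTop = 0 := by
  have hens : ∀ n, IsGaussianEnsemble β₀ (μ n) := fun n =>
    ⟨hμprob n, Z n, hZ n, by rw [← hβ n]; exact hμ n⟩
  have hcount : ∀ (n : ℕ) (r : ℝ), Measurable fun y : Fin n → ℝ => countIn n y (window n x r) := by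
    intro n r
    have h := measurable_countIn n (I := window n x r) measurableSet_Ioo
    refine measurable_to_countable' fun k => ?_
    convert h (measurableSet_singleton (k : ℝ)) using 1
    ext y
    simp
  have hmany : ∀ᵐ ω ∂P, ∀ q k : ℕ,
      ∃ᶠ n in atTop, ω n ∈ {y | k ≤ countIn n y (window n x (1 / (q + 1)))} := by
    refine ae_all_iff.2 fun q => ae_all_iff.2 fun k => ?_
    obtain ⟨c, hc, N, h⟩ := exists_le_measure_le_countIn hβ₀ hx
      (by positivity : (0 : ℝ) < 1 / (q + 1)) k
    exact ae_frequently_mem hP (fun n => measurableSet_le measurable_const (hcount n _)) hc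
      fun n hn => h (hens n) hn
  have hnone : ∀ᵐ ω ∂P, ∀ q : ℕ,
      ∃ᶠ n in atTop, ω n ∈ {y | countIn n y (window n x (q + 1)) = 0} := by
    refine ae_all_iff.2 fun q => ?_
    obtain ⟨c, hc, N, h⟩ := exists_le_measure_countIn_eq_zero hβ₀ hx
      (by positivity : (0 : ℝ) < q + 1)
    exact ae_frequently_mem hP (fun n => hcount n _ (measurableSet_singleton 0)) hc
      fun n hn => h (hens n) hn
  filter_upwards [hmany, hnone] with ω hω hω' L hL
  constructor
  · obtain ⟨q, hq⟩ := exists_nat_one_div_lt hL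
    refine limsup_natCast_eq_top fun k => (hω q k).mono fun n hn => le_trans hn ?_
    exact countIn_le_countIn fun j hj => window_subset_window n x hq.le hj
  · obtain ⟨q, hq⟩ := exists_nat_ge L
    refine liminf_natCast_eq_zero ((hω' q).mono fun n hn => Nat.le_zero.1 (le_trans ?_ hn.le))
    exact countIn_le_countIn fun j hj => window_subset_window n x (by linarith) hj
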